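/- Let M=(I,V,E) be an iMAG, T⊆I∪V, A⊆V∖T, and B,C⊆(I∪V)∖T pairwise disjoint. Then A is id-separated from B given C∪T in the hard-manipulated graph M_{do(T)} if and only if, for every isADMG A'∈[M]_G, A is id-separated from B given C∪T∪S_{A'} in A'_{do(T)}. -/

import Mathlib

noncomputable section
open Classical

/-- Edge-endpoint marks: tail `−`, arrowhead `>`, or circle `∘`. -/
inductive Mark : Type
  | tail
  | arrow
  | circle
  deriving DecidableEq

/-- A mixed graph with input nodes over a node type `N`, as raw data.
`mark a b` is the mark at `a` on the (unique) edge between `a` and `b`,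
or `none` if there is no edge between `a` and `b`. -/
structure MixedGraph (N : Type) where
  inputs : Set N
  outputs : Set N
  mark : N → N → Option Mark

namespace MixedGraph

variable {N N' : Type}

/-- All nodes of the graph. -/
def nodes (G : MixedGraph N) : Set N := G.inputs ∪ G.outputs

/-- `a` and `b` are adjacent (joined by an edge). -/
def adj (G : MixedGraph N) (a b : N) : Prop := (G.mark a b).isSome

/-- Directed edge `a → b`: tail at `a`, arrowhead at `b`. -/
def dir (G : MixedGraph N) (a b : N) : Prop :=
  G.mark a b = some Mark.tail ∧ G.mark b a = some Mark.arrow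

/-- Bidirected edge `a ↔ b`. -/
def bidir (G : MixedGraph N) (a b : N) : Prop :=
  G.mark a b = some Mark.arrow ∧ G.mark b a = some Mark.arrow

/-- Undirected edge `a − b`. -/
def undir (G : MixedGraph N) (a b : N) : Prop :=
  G.mark a b = some Mark.tail ∧ G.mark b a = some Mark.tail

/-- Edge `a ∘→ b`: circle at `a`, arrowhead at `b`. -/
def circArrow (G : MixedGraph N) (a b : N) : Prop :=
  G.mark a b = some Mark.circle ∧ G.mark b a = some Mark.arrow

/-- Edge `a ∘−∘ b`: circles at both ends. -/
def circCirc (G : MixedGraph N) (a b : N) : Prop :=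
  G.mark a b = some Mark.circle ∧ G.mark b a = some Mark.circle

/-- Edge `a ∘− b`: circle at `a`, tail at `b`. -/
def circTail (G : MixedGraph N) (a b : N) : Prop :=
  G.mark a b = some Mark.circle ∧ G.mark b a = some Mark.tail

/-- Edge `a −∘ b`: tail at `a`, circle at `b`. -/
def tailCirc (G : MixedGraph N) (a b : N) : Prop :=
  G.mark a b = some Mark.tail ∧ G.mark b a = some Mark.circle

/-- Some edge of `G` carries an arrowhead at `a`. -/
def arrowAt (G : MixedGraph N) (a : N) : Prop :=
  ∃ b, G.mark a b = some Mark.arrow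

/-- `a` is an ancestor of `b`: `a = b` or a directed path `a → ⋯ → b` exists. -/
def anc (G : MixedGraph N) : N → N → Prop := Relation.ReflTransGen G.dir

/-- The ancestors of a set `S` of nodes. -/
def ancSet (G : MixedGraph N) (S : Set N) : Set N := {a | ∃ s ∈ S, G.anc a s}

/-- Potentially directed edge from `a` towards `b`: an edge with no arrowhead at its
earlier endpoint `a` and no tail at its later endpoint `b`. -/
def potDir (G : MixedGraph N) (a b : N) : Prop :=
  G.adj a b ∧ G.mark a b ≠ some Mark.arrow ∧ G.mark b a ≠ some Mark.tail

/-- `a` is a possible ancestor of `b`: `a = b` or a potentially directed path runs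
from `a` to `b`. -/
def poAn (G : MixedGraph N) : N → N → Prop := Relation.ReflTransGen G.potDir

/-- The possible ancestors of a set `S` of nodes. -/
def poAnSet (G : MixedGraph N) (S : Set N) : Set N := {a | ∃ s ∈ S, G.poAn a s}

/-- Well-formedness of a mixed graph with input nodes: inputs and outputs are disjoint
finite sets, edges are symmetric and irreflexive and join nodes of the graph. -/
def WF (G : MixedGraph N) : Prop :=
  Disjoint G.inputs G.outputs ∧ G.inputs.Finite ∧ G.outputs.Finite ∧
  (∀ a b, (G.mark a b).isSome → (G.mark b a).isSome) ∧
  (∀ a, G.mark a a = none) ∧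
  (∀ a b, (G.mark a b).isSome → a ∈ G.nodes ∧ b ∈ G.nodes)

/-- The induced subgraph of `G` over the node set `A`. -/
def induce (G : MixedGraph N) (A : Set N) : MixedGraph N where
  inputs := G.inputs ∩ A
  outputs := G.outputs ∩ A
  mark := fun a b => if a ∈ A ∧ b ∈ A then G.mark a b else none

/-- Transport a mixed graph over `N` to one over `N ⊕ N'` along `Sum.inl`. -/
def sumInl (G : MixedGraph N) : MixedGraph (N ⊕ N') where
  inputs := Sum.inl '' G.inputs
  outputs := Sum.inl '' G.outputs
  mark := fun x y =>
    match x, y with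
    | Sum.inl a, Sum.inl b => G.mark a b
    | _, _ => none

/-- `G` is a subgraph of `H`: its nodes and marked edges are among those of `H`. -/
def Subgraph (G H : MixedGraph N) : Prop :=
  G.inputs ⊆ H.inputs ∧ G.outputs ⊆ H.outputs ∧
  ∀ a b m, G.mark a b = some m → H.mark a b = some m

end MixedGraph

/-- A walk in `G` with `len` edges, visiting the nodes `f 0, …, f len`
(consecutive nodes are adjacent). -/
structure GWalk {N : Type} (G : MixedGraph N) where
  len : ℕ
  f : ℕ → N
  hadj : ∀ i < len, G.adj (f i) (f (i + 1))

namespace GWalk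

variable {N : Type} {G : MixedGraph N}

/-- The first node of the walk. -/
def first (w : GWalk G) : N := w.f 0

/-- The last node of the walk. -/
def last (w : GWalk G) : N := w.f w.len

/-- The walk is a path: no repeated nodes. -/
def IsPath (w : GWalk G) : Prop :=
  ∀ i ≤ w.len, ∀ j ≤ w.len, w.f i = w.f j → i = j

/-- The (interior) node at position `i` is a collider on the walk: both incident
edges carry arrowheads at it. -/
def ColliderAt (w : GWalk G) (i : ℕ) : Prop :=
  G.mark (w.f i) (w.f (i - 1)) = some Mark.arrow ∧
  G.mark (w.f i) (w.f (i + 1)) = some Mark.arrow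

end GWalk

namespace MixedGraph

variable {N : Type}

/-- `w` is an `(L,S)`-inducing walk: every non-endnode is in `L` or a collider, and
every collider lies in `Anc({first, last} ∪ S)`. -/
def InducingWalk (G : MixedGraph N) (L S : Set N) (w : GWalk G) : Prop :=
  (∀ i, 0 < i → i < w.len → w.f i ∈ L ∨ w.ColliderAt i) ∧
  (∀ i, 0 < i → i < w.len → w.ColliderAt i →
    w.f i ∈ G.ancSet ({w.first, w.last} ∪ S))

/-- There is an `(L,S)`-inducing walk from `a` to `b` in `G`. -/
def InducingWalkBtw (G : MixedGraph N) (L S : Set N) (a b : N) : Prop :=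
  ∃ w : GWalk G, w.first = a ∧ w.last = b ∧ G.InducingWalk L S w

/-- There is an `(L,S)`-inducing path from `a` to `b` in `G`. -/
def InducingPathBtw (G : MixedGraph N) (L S : Set N) (a b : N) : Prop :=
  ∃ w : GWalk G, w.IsPath ∧ w.first = a ∧ w.last = b ∧ G.InducingWalk L S w

/-- `G` is an iADMG: all edges directed or bidirected, no directed cycles, no
arrowheads at input nodes, and no edges between two input nodes. -/
def IsIADMG (G : MixedGraph N) : Prop :=
  G.WF ∧
  (∀ a b, G.adj a b → G.dir a b ∨ G.dir b a ∨ G.bidir a b) ∧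
  (∀ a b, G.dir a b → ¬ G.anc b a) ∧
  (∀ a ∈ G.inputs, ∀ b, G.mark a b ≠ some Mark.arrow) ∧
  (∀ a ∈ G.inputs, ∀ b ∈ G.inputs, ¬ G.adj a b)

/-- `G` is an iPAG. -/
def IsIPAG (G : MixedGraph N) : Prop :=
  G.WF ∧
  (∀ a ∈ G.inputs, ∀ b, G.mark a b ≠ some Mark.arrow) ∧
  (∀ a ∈ G.inputs, ∀ b ∈ G.inputs, ¬ G.adj a b) ∧
  (∀ a b, G.dir a b → ¬ G.anc b a) ∧
  (∀ a b, G.anc a b → ¬ G.bidir b a) ∧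
  (∀ a b c, G.mark b a = some Mark.arrow → ¬ G.undir b c) ∧
  (∀ a b, a ≠ b → a ∈ G.nodes → b ∈ G.nodes → ¬ G.adj a b →
    ¬ G.InducingPathBtw ∅ ∅ a b)

/-- `G` is an iMAG: an iPAG with no circle marks. -/
def IsIMAG (G : MixedGraph N) : Prop :=
  G.IsIPAG ∧ ∀ a b, G.mark a b ≠ some Mark.circle

/-- The visibility condition for a directed edge `a → b` of `G`: either `a` is an
input node, or some node `c` not adjacent to `b` satisfies `c *→ a`, or there is a
path `c *→ v₁ ↔ ⋯ ↔ v_{n−1} ↔ a` (`n ≥ 2`) with every `vᵢ` a parent of `b`. -/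
def VisibleCond (G : MixedGraph N) (a b : N) : Prop :=
  a ∈ G.inputs ∨
  ∃ c, c ≠ b ∧ ¬ G.adj c b ∧
    (G.mark a c = some Mark.arrow ∨
      ∃ w : GWalk G, w.IsPath ∧ 2 ≤ w.len ∧ w.first = c ∧ w.last = a ∧
        G.mark (w.f 1) (w.f 0) = some Mark.arrow ∧
        (∀ i, 1 ≤ i → i < w.len → G.bidir (w.f i) (w.f (i + 1))) ∧
        (∀ i, 1 ≤ i → i < w.len → G.dir (w.f i) b))

/-- `a → b` is a visible directed edge of `G`. -/
def VisibleDir (G : MixedGraph N) (a b : N) : Prop :=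
  G.dir a b ∧ G.VisibleCond a b

/-- `a` and `b` are in the same bucket of `G`: some path between them carries no
arrowhead mark on any of its edges. -/
def SameBucket (G : MixedGraph N) (a b : N) : Prop :=
  ∃ w : GWalk G, w.IsPath ∧ w.first = a ∧ w.last = b ∧
    ∀ i < w.len, G.mark (w.f i) (w.f (i + 1)) ≠ some Mark.arrow ∧
      G.mark (w.f (i + 1)) (w.f i) ≠ some Mark.arrow

end MixedGraph

/-- An isADMG: an iADMG together with its set `sel` of latent selection nodes.
The observed output nodes are `graph.outputs \ sel`. -/
structure SADMG (N : Type) where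
  graph : MixedGraph N
  sel : Set N

namespace SADMG

/-- Well-formedness of an isADMG. -/
def WF {N : Type} (A : SADMG N) : Prop :=
  A.graph.IsIADMG ∧ A.sel ⊆ A.graph.outputs

/-- The observed output nodes `O`. -/
def obs {N : Type} (A : SADMG N) : Set N := A.graph.outputs \ A.sel

end SADMG

/-- An ilsADMG: an iADMG together with its sets of latent output nodes and of
latent selection nodes.  The observed output nodes are the remaining outputs. -/
structure LSADMG (N : Type) where
  graph : MixedGraph N
  latent : Set N
  sel : Set N

namespace LSADMG

/-- Well-formedness of an ilsADMG. -/
def WF {N : Type} (A : LSADMG N) : Prop :=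
  A.graph.IsIADMG ∧ A.latent ⊆ A.graph.outputs ∧ A.sel ⊆ A.graph.outputs ∧
  Disjoint A.latent A.sel

/-- The observed output nodes `O`. -/
def obs {N : Type} (A : LSADMG N) : Set N := A.graph.outputs \ (A.latent ∪ A.sel)

end LSADMG

/-- An iPAG/iMAG `P` represents the isADMG `A`: nodes match; adjacency in `P`
corresponds exactly to `S`-inducing paths in `A` (with no edges inside the inputs);
arrowheads at `a` imply `a ∉ Anc_A({b} ∪ S)`; tails at `a` imply `a ∈ Anc_A({b} ∪ S)`. -/
def RepresentsS {N : Type} (P : MixedGraph N) (A : SADMG N) : Prop :=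
  P.inputs = A.graph.inputs ∧
  P.outputs = A.obs ∧
  (∀ a b, a ≠ b → a ∈ P.nodes → b ∈ P.nodes →
    (P.adj a b ↔
      (¬(a ∈ P.inputs ∧ b ∈ P.inputs) ∧ A.graph.InducingPathBtw ∅ A.sel a b))) ∧
  (∀ a b, P.mark a b = some Mark.arrow → a ∉ A.graph.ancSet ({b} ∪ A.sel)) ∧
  (∀ a b, P.mark a b = some Mark.tail → a ∈ A.graph.ancSet ({b} ∪ A.sel))

/-- An iPAG/iMAG `P` `(L,S)`-represents the ilsADMG `A`. -/
def RepresentsLS {N : Type} (P : MixedGraph N) (A : LSADMG N) : Prop :=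
  P.inputs = A.graph.inputs ∧
  P.outputs = A.obs ∧
  (∀ a b, a ≠ b → a ∈ P.nodes → b ∈ P.nodes →
    (P.adj a b ↔
      (¬(a ∈ P.inputs ∧ b ∈ P.inputs) ∧ A.graph.InducingPathBtw A.latent A.sel a b))) ∧
  (∀ a b, P.mark a b = some Mark.arrow → a ∉ A.graph.ancSet ({b} ∪ A.sel)) ∧
  (∀ a b, P.mark a b = some Mark.tail → a ∈ A.graph.ancSet ({b} ∪ A.sel))

/-- The explicit candidate for `MAG(A)` of an ilsADMG `A`: input nodes `I`, output
nodes `O`; distinct `a,b ∈ I ∪ O` adjacent iff `{a,b} ⊄ I` and there is an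
`(L,S)`-inducing path between them in `A`; the mark at `a` on each edge is a tail
if `a ∈ Anc_A({b} ∪ S)` and an arrowhead otherwise. -/
def magOfLS {N : Type} (A : LSADMG N) : MixedGraph N where
  inputs := A.graph.inputs
  outputs := A.obs
  mark := fun a b =>
    if a ≠ b ∧ a ∈ A.graph.inputs ∪ A.obs ∧ b ∈ A.graph.inputs ∪ A.obs ∧
        ¬(a ∈ A.graph.inputs ∧ b ∈ A.graph.inputs) ∧
        A.graph.InducingPathBtw A.latent A.sel a b then
      (if a ∈ A.graph.ancSet ({b} ∪ A.sel) then some Mark.tail else some Mark.arrow)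
    else none

/-- A walk is `C`-open (in a graph without circle marks): its endnodes are not in
`C`, no non-collider on it is in `C`, and every collider on it is in `Anc(C)`. -/
def COpen {N : Type} (H : MixedGraph N) (C : Set N) (w : GWalk H) : Prop :=
  w.first ∉ C ∧ w.last ∉ C ∧
  ∀ i, 0 < i → i < w.len →
    (¬ w.ColliderAt i → w.f i ∉ C) ∧ (w.ColliderAt i → w.f i ∈ H.ancSet C)

/-- `A` is id-separated from `B` given `C` in `H` (graphs without circle marks):
every path/walk from a node of `A` to a node of `B ∪ inputs` is not `C`-open. -/
def IdSepSimple {N : Type} (H : MixedGraph N) (A B C : Set N) : Prop :=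
  ∀ w : GWalk H, w.first ∈ A → w.last ∈ B ∪ H.inputs → ¬ COpen H C w

/-- A walk in a manipulated graph `H` (with set `DI` of regime input nodes) is
`C`-id-open. -/
def IdOpen {N : Type} (H : MixedGraph N) (DI C : Set N) (w : GWalk H) : Prop :=
  w.first ∉ C ∧ w.last ∉ C ∧
  ∀ i, 0 < i → i < w.len →
    (w.f i ∉ C ∧ (H.mark (w.f i) (w.f (i - 1)) = some Mark.tail ∨
        H.mark (w.f i) (w.f (i + 1)) = some Mark.tail)) ∨
    (w.f i ∉ C ∧ H.mark (w.f i) (w.f (i - 1)) = some Mark.circle ∧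
        H.mark (w.f i) (w.f (i + 1)) = some Mark.circle ∧
        ¬ H.adj (w.f (i - 1)) (w.f (i + 1))) ∨
    (w.ColliderAt i ∧ w.f (i - 1) ∉ DI ∧ w.f i ∉ DI ∧ w.f (i + 1) ∉ DI ∧
        w.f i ∈ H.ancSet C) ∨
    (w.ColliderAt i ∧ ¬(w.f (i - 1) ∉ DI ∧ w.f i ∉ DI ∧ w.f (i + 1) ∉ DI) ∧
        w.f i ∈ H.poAnSet (C ∩ H.outputs)) ∨
    (w.f (i - 1) ∈ DI ∧ H.mark (w.f i) (w.f (i - 1)) = some Mark.circle ∧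
        H.mark (w.f i) (w.f (i + 1)) = some Mark.arrow ∧
        w.f i ∈ H.poAnSet (C ∩ H.outputs)) ∨
    (w.f (i + 1) ∈ DI ∧ H.mark (w.f i) (w.f (i - 1)) = some Mark.arrow ∧
        H.mark (w.f i) (w.f (i + 1)) = some Mark.circle ∧
        w.f i ∈ H.poAnSet (C ∩ H.outputs))

/-- `A` is id-separated from `B` given `C` in the manipulated graph `H`, whose set
of regime input nodes is `DI`: every path/walk from a node of `A` to a node of
`B ∪ inputs` is not `C`-id-open. -/
def IdSep {N : Type} (H : MixedGraph N) (DI A B C : Set N) : Prop :=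
  ∀ w : GWalk H, w.first ∈ A → w.last ∈ B ∪ H.inputs → ¬ IdOpen H DI C w

/-- Hard manipulation `do(T)` of an isADMG-type graph: reclassify the nodes of `T`
as input nodes and delete every edge with an arrowhead at a node of `T`. -/
def admgHardManip {N : Type} (G : MixedGraph N) (T : Set N) : MixedGraph N where
  inputs := G.inputs ∪ (T ∩ G.outputs)
  outputs := G.outputs \ T
  mark := fun x y =>
    if (x ∈ T ∧ G.mark x y = some Mark.arrow) ∨
        (y ∈ T ∧ G.mark y x = some Mark.arrow) then none
    else G.mark x y

/-- Soft manipulation `do(I_D)` of an isADMG-type graph: add a fresh input node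
`I_d = Sum.inr d` and the directed edge `I_d → d` for each `d ∈ D`. -/
def admgSoftManip {N : Type} (G : MixedGraph N) (D : Set N) : MixedGraph (N ⊕ N) where
  inputs := Sum.inl '' G.inputs ∪ Sum.inr '' D
  outputs := Sum.inl '' G.outputs
  mark := fun x y =>
    match x, y with
    | Sum.inl a, Sum.inl b => G.mark a b
    | Sum.inr d, Sum.inl a => if d ∈ D ∧ a = d then some Mark.tail else none
    | Sum.inl a, Sum.inr d => if d ∈ D ∧ a = d then some Mark.arrow else none
    | Sum.inr _, Sum.inr _ => none

/-- Soft manipulation of an isADMG. -/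
def SADMG.softManip {N : Type} (A : SADMG N) (D : Set N) : SADMG (N ⊕ N) where
  graph := admgSoftManip A.graph D
  sel := Sum.inl '' A.sel

/-- Hard manipulation `do(T)` of an iMAG-type graph: input nodes `I ∪ (T ∩ V)`,
output nodes `V \ T`; delete all edges with an arrowhead at a node of `T \ I` and
all edges between two nodes of `T ∪ I`. -/
def magHardManip {N : Type} (G : MixedGraph N) (T : Set N) : MixedGraph N where
  inputs := G.inputs ∪ (T ∩ G.outputs)
  outputs := G.outputs \ T
  mark := fun x y =>
    if (x ∈ T ∧ x ∉ G.inputs ∧ G.mark x y = some Mark.arrow) ∨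
        (y ∈ T ∧ y ∉ G.inputs ∧ G.mark y x = some Mark.arrow) ∨
        ((x ∈ T ∨ x ∈ G.inputs) ∧ (y ∈ T ∨ y ∈ G.inputs)) then none
    else G.mark x y

/-- The mark at node `y` on the new edge between the regime node `I_a = Sum.inr a`
and `y` in the soft manipulation of an iMAG-type graph `G` over `N ⊕ N`
(`none` if there is no such edge): `I_a → a` if some edge of `G` has an arrowhead
at `a`; `I_a − a` if some undirected edge is at `a`; `I_a −∘ a` otherwise;
`I_a → b` for every output `b` with `a → b` invisible; `I_a − b` for every output
`b` with `a − b` in `G`. -/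
def magSoftTarget {N : Type} (G : MixedGraph (N ⊕ N)) (a : N) (y : N ⊕ N) : Option Mark :=
  if y = Sum.inl a then
    (if G.arrowAt (Sum.inl a) then some Mark.arrow
     else if ∃ c, G.undir (Sum.inl a) c then some Mark.tail
     else some Mark.circle)
  else if y ∈ G.outputs ∧ G.dir (Sum.inl a) y ∧ ¬ G.VisibleCond (Sum.inl a) y then
    some Mark.arrow
  else if y ∈ G.outputs ∧ G.undir (Sum.inl a) y then some Mark.tail
  else none

/-- The mark at node `y` on the new edge between the regime node `I_a = Sum.inr a`
and `y` in the soft manipulation of an iPAG-type graph `G` over `N ⊕ N`. -/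
def pagSoftTarget {N : Type} (G : MixedGraph (N ⊕ N)) (a : N) (y : N ⊕ N) : Option Mark :=
  if y = Sum.inl a then
    (if G.arrowAt (Sum.inl a) then some Mark.arrow
     else if ∃ c, G.undir (Sum.inl a) c then some Mark.tail
     else some Mark.circle)
  else if y ∈ G.outputs ∧ ((G.dir (Sum.inl a) y ∧ ¬ G.VisibleCond (Sum.inl a) y) ∨
      G.circArrow (Sum.inl a) y) then some Mark.arrow
  else if y ∈ G.outputs ∧ (G.undir (Sum.inl a) y ∨
      (G.circTail (Sum.inl a) y ∧ ∃ c, G.undir c y)) then some Mark.tail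
  else if y ∈ G.outputs ∧ (G.tailCirc (Sum.inl a) y ∨ G.circCirc (Sum.inl a) y ∨
      (G.circTail (Sum.inl a) y ∧ ¬ ∃ c, G.undir c y)) then some Mark.circle
  else none

/-- Generic soft-manipulation step on a graph over `N ⊕ N`: for each `a ∈ A` not
already an input, the regime node `I_a = Sum.inr a` is added as an input node,
with edges (and end marks) prescribed by `target`; the mark at `I_a` on each new
edge is a tail. -/
def softManipStep {N : Type}
    (target : MixedGraph (N ⊕ N) → N → (N ⊕ N) → Option Mark)
    (G : MixedGraph (N ⊕ N)) (A : Set N) : MixedGraph (N ⊕ N) where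
  inputs := G.inputs ∪ Sum.inr '' {a | a ∈ A ∧ Sum.inl a ∉ G.inputs}
  outputs := G.outputs
  mark := fun x y =>
    match x, y with
    | Sum.inr a, Sum.inr b =>
        if a ∈ A ∧ Sum.inl a ∉ G.inputs then
          (if (target G a (Sum.inr b)).isSome then some Mark.tail else none)
        else if b ∈ A ∧ Sum.inl b ∉ G.inputs then target G b (Sum.inr a)
        else G.mark x y
    | Sum.inr a, Sum.inl v =>
        if a ∈ A ∧ Sum.inl a ∉ G.inputs then
          (if (target G a (Sum.inl v)).isSome then some Mark.tail else none)
        else G.mark x y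
    | Sum.inl v, Sum.inr a =>
        if a ∈ A ∧ Sum.inl a ∉ G.inputs then target G a (Sum.inl v)
        else G.mark x y
    | Sum.inl _, Sum.inl _ => G.mark x y

/-- Soft-manipulation step for iMAG-type graphs over `N ⊕ N`. -/
def magSoftManipStep {N : Type} (G : MixedGraph (N ⊕ N)) (A : Set N) :
    MixedGraph (N ⊕ N) :=
  softManipStep magSoftTarget G A

/-- The soft-manipulated iMAG `M_{do(I_A)}`, over node type `N ⊕ N`. -/
def magSoftManip {N : Type} (M : MixedGraph N) (A : Set N) : MixedGraph (N ⊕ N) :=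
  magSoftManipStep M.sumInl A

/-- The soft-manipulated iPAG `P_{do(I_A)}`, over node type `N ⊕ N`. -/
def pagSoftManip {N : Type} (P : MixedGraph N) (A : Set N) : MixedGraph (N ⊕ N) :=
  softManipStep pagSoftTarget P.sumInl A

/-- Hard manipulation `do(T)` of an iPAG-type graph: as for iMAGs, but in addition
every remaining circle mark at a manipulated node is replaced by a tail. -/
def pagHardManip {N : Type} (G : MixedGraph N) (T : Set N) : MixedGraph N where
  inputs := G.inputs ∪ T
  outputs := G.outputs \ T
  mark := fun x y =>
    if (x ∈ T ∧ x ∉ G.inputs ∧ G.mark x y = some Mark.arrow) ∨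
        (y ∈ T ∧ y ∉ G.inputs ∧ G.mark y x = some Mark.arrow) ∨
        ((x ∈ T ∨ x ∈ G.inputs) ∧ (y ∈ T ∨ y ∈ G.inputs)) then none
    else if x ∈ T ∧ x ∉ G.inputs ∧ y ∈ G.outputs ∧ y ∉ T ∧
        G.mark x y = some Mark.circle then some Mark.tail
    else G.mark x y

/-- Orient all circle marks of `G` as tails. -/
def orientCirclesTails {N : Type} (G : MixedGraph N) : MixedGraph N :=
  { G with
    mark := fun x y =>
      (G.mark x y).map (fun m => if m = Mark.circle then Mark.tail else m) }

/-- There is a pc-connecting path from `a` to `b` in `G`: a single edge between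
`a` and `b` that is not a visible directed edge, or a path
`a *→ v₁ ↔ ⋯ ↔ v_{n−1} ←* b` (`n > 1`) none of whose edges is visible directed. -/
def PcConn {N : Type} (G : MixedGraph N) (a b : N) : Prop :=
  (G.adj a b ∧ ¬ G.VisibleDir a b ∧ ¬ G.VisibleDir b a) ∨
  (∃ w : GWalk G, w.IsPath ∧ 1 < w.len ∧ w.first = a ∧ w.last = b ∧
    G.mark (w.f 1) (w.f 0) = some Mark.arrow ∧
    G.mark (w.f (w.len - 1)) (w.f w.len) = some Mark.arrow ∧
    (∀ i, 1 ≤ i → i < w.len - 1 → G.bidir (w.f i) (w.f (i + 1))) ∧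
    (∀ i < w.len, ¬ G.VisibleDir (w.f i) (w.f (i + 1)) ∧
      ¬ G.VisibleDir (w.f (i + 1)) (w.f i)))

/-- The pc-component of `b` in `G`. -/
def pcSet {N : Type} (G : MixedGraph N) (b : N) : Set N := {a | PcConn G a b}

/-- The region of a set `B` in `G`: all nodes in the bucket of some node
pc-connected to a node of `B`. -/
def regionSet {N : Type} (G : MixedGraph N) (B : Set N) : Set N :=
  {a | ∃ b ∈ B, ∃ c, PcConn G c b ∧ G.SameBucket a c}

/-- `S` is a bucket of `G`. -/
def IsBucket {N : Type} (G : MixedGraph N) (S : Set N) : Prop :=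
  ∃ a ∈ G.nodes, S = {x | G.SameBucket x a}

/-- FCI rule R1 (closure form): if `k *→ j` with the edge between `j` and `i`
carrying a circle at `j`, `i` and `k` non-adjacent and `i` not an input node,
then that edge is `j → i`. -/
def FciR1 {N : Type} (P : MixedGraph N) : Prop :=
  ∀ i j k, P.mark j k = some Mark.arrow → ¬ P.adj i k → i ∉ P.inputs →
    P.mark j i = some Mark.circle → P.dir j i

/-- FCI rule R2 (closure form): if `i → j *→ k` or `i *→ j → k` with the edge
between `i` and `k` carrying a circle at `k`, then that edge has an arrowhead at `k`. -/
def FciR2 {N : Type} (P : MixedGraph N) : Prop :=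
  ∀ i j k, ((P.dir i j ∧ P.mark k j = some Mark.arrow) ∨
      (P.mark j i = some Mark.arrow ∧ P.dir j k)) →
    P.mark k i = some Mark.circle → P.mark k i = some Mark.arrow

/-- FCI rule R4 (closure form): for every discriminating path `⟨a,…,y,z⟩` for `y`,
the mark at `y` on the edge between `y` and `z` is not a circle. -/
def FciR4 {N : Type} (P : MixedGraph N) : Prop :=
  ∀ w : GWalk P, w.IsPath → 3 ≤ w.len → ¬ P.adj (w.f 0) (w.f w.len) →
    (∀ i, 0 < i → i < w.len - 1 → w.ColliderAt i ∧ P.dir (w.f i) (w.f w.len)) →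
    P.mark (w.f (w.len - 1)) (w.f w.len) ≠ some Mark.circle

/-- Property (P2) of iSOPAGs: no `a *→ b` together with `b −∘ c`, and no
`a *→ b` together with `b ∘− c`. -/
def SopagP2 {N : Type} (P : MixedGraph N) : Prop :=
  ∀ a b c, P.mark b a = some Mark.arrow → ¬ P.tailCirc b c ∧ ¬ P.circTail b c

/-- Property (P3) of iSOPAGs: if `a *→ b` and the edge between `b` and `c` has a
circle at `b`, then `a *→ c`. -/
def SopagP3 {N : Type} (P : MixedGraph N) : Prop :=
  ∀ a b c, P.mark b a = some Mark.arrow → P.mark b c = some Mark.circle →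
    P.mark c a = some Mark.arrow

/-- `P` is an iSOPAG: an iPAG representing some isADMG, closed under the FCI
orientation rules (R1, R2, R4), and satisfying (P2) and (P3). -/
def IsISOPAG {N : Type} (P : MixedGraph N) : Prop :=
  P.IsIPAG ∧ (∃ A : SADMG N, A.WF ∧ RepresentsS P A) ∧
  FciR1 P ∧ FciR2 P ∧ FciR4 P ∧ SopagP2 P ∧ SopagP3 P

/-- The sequence `f` with the `d` entries after position `j` removed. -/
def skipAfter {N : Type} (f : ℕ → N) (j d : ℕ) : ℕ → N :=
  fun i => if i ≤ j then f i else f (i + d)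

theorem skipAfter_of_le {N : Type} (f : ℕ → N) {j d i : ℕ} (h : i ≤ j) :
    skipAfter f j d i = f i := if_pos h

theorem skipAfter_of_lt {N : Type} (f : ℕ → N) {j d i : ℕ} (h : j < i) :
    skipAfter f j d i = f (i + d) := if_neg (by omega)

theorem skipAfter_of_ge {N : Type} (f : ℕ → N) {j d i : ℕ} (hf : f j = f (j + d))
    (h : j ≤ i) : skipAfter f j d i = f (i + d) := by
  rcases h.eq_or_lt with rfl | h
  · rw [skipAfter_of_le f le_rfl, hf]
  · exact skipAfter_of_lt f h

namespace MixedGraph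

variable {N : Type} {G : MixedGraph N}

theorem ancSet_mono {S S' : Set N} (h : S ⊆ S') : G.ancSet S ⊆ G.ancSet S' :=
  fun _ ⟨s, hs, ha⟩ => ⟨s, h hs, ha⟩

theorem subset_ancSet (S : Set N) : S ⊆ G.ancSet S := fun s hs => ⟨s, hs, .refl⟩

theorem anc.mem_ancSet {a b : N} {S : Set N} (h : G.anc a b) (hb : b ∈ G.ancSet S) :
    a ∈ G.ancSet S :=
  let ⟨s, hs, hbs⟩ := hb
  ⟨s, hs, h.trans hbs⟩

theorem mem_ancSet_singleton_union {a b : N} {S : Set N} :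
    a ∈ G.ancSet ({b} ∪ S) ↔ G.anc a b ∨ a ∈ G.ancSet S := by
  constructor
  · rintro ⟨s, rfl | hs, h⟩
    · exact .inl h
    · exact .inr ⟨s, hs, h⟩
  · rintro (h | h)
    · exact ⟨b, .inl rfl, h⟩
    · exact ancSet_mono (by simp) h

theorem mem_ancSet_pair_union {a b c : N} {S : Set N} :
    a ∈ G.ancSet ({b, c} ∪ S) ↔ G.anc a b ∨ G.anc a c ∨ a ∈ G.ancSet S := by
  constructor
  · rintro ⟨s, (rfl | rfl) | hs, h⟩
    · exact .inl h
    · exact .inr (.inl h)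
    · exact .inr (.inr ⟨s, hs, h⟩)
  · rintro (h | h | h)
    · exact ⟨b, .inl (.inl rfl), h⟩
    · exact ⟨c, .inl (.inr rfl), h⟩
    · exact ancSet_mono (by simp) h

theorem IsIADMG.anc_antisymm (hG : G.IsIADMG) {a b : N} (hab : G.anc a b)
    (hba : G.anc b a) : a = b := by
  rcases Relation.ReflTransGen.cases_head hab with h | ⟨c, hac, hcb⟩
  · exact h
  · exact absurd (hcb.trans hba) (hG.2.2.1 a c hac)

theorem IsIADMG.dir_of_adj (hG : G.IsIADMG) {a b : N} (h : G.adj a b)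
    (hm : G.mark a b ≠ some Mark.arrow) : G.dir a b := by
  rcases hG.2.1 a b h with h | h | h
  · exact h
  · exact absurd h.2 hm
  · exact absurd h.1 hm

theorem WF.adj_symm (hG : G.WF) {a b : N} (h : G.adj a b) : G.adj b a := hG.2.2.2.1 a b h

theorem WF.ne_of_adj (hG : G.WF) {a b : N} (h : G.adj a b) : a ≠ b := by
  rintro rfl
  simp [adj, hG.2.2.2.2.1 a] at h

theorem adj_of_mark {a b : N} {m : Mark} (h : G.mark a b = some m) : G.adj a b := by
  simp [adj, h]

/-- The walk consisting of a single edge. -/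
def edgeWalk {a b : N} (h : G.adj a b) : GWalk G where
  len := 1
  f := fun i => if i = 0 then a else b
  hadj := by
    intro i hi
    obtain rfl : i = 0 := by omega
    simpa using h

theorem inducingWalk_edgeWalk {a b : N} (h : G.adj a b) (L S : Set N) :
    G.InducingWalk L S (edgeWalk h) := by
  constructor <;> intro i h0 h1 <;> simp only [edgeWalk] at h1 <;> omega

/-- An inducing walk can be shortened to an inducing path. -/
theorem InducingWalkBtw.inducingPathBtw {S : Set N} {a b : N}
    (h : G.InducingWalkBtw ∅ S a b) : G.InducingPathBtw ∅ S a b := by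
  obtain ⟨w, ha, hb, hw⟩ := h
  induction hn : w.len using Nat.strong_induction_on generalizing w with
  | _ n ih =>
  subst hn
  by_cases hp : w.IsPath
  · exact ⟨w, hp, ha, hb, hw⟩
  obtain ⟨i, j, hij, hj, hf⟩ : ∃ i j, i < j ∧ j ≤ w.len ∧ w.f i = w.f j := by
    simp only [GWalk.IsPath, not_forall] at hp
    obtain ⟨i, hi, j, hj, hf, hne⟩ := hp
    rcases lt_or_gt_of_ne hne with h | h
    · exact ⟨i, j, h, hj, hf⟩
    · exact ⟨j, i, h, hi, hf.symm⟩
  obtain ⟨d, rfl⟩ : ∃ d, j = i + d := ⟨j - i, by omega⟩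
  have hlo : ∀ k, k ≤ i → skipAfter w.f i d k = w.f k := fun k => skipAfter_of_le _
  have hhi : ∀ k, i ≤ k → skipAfter w.f i d k = w.f (k + d) := fun k => skipAfter_of_ge _ hf
  let w' : GWalk G :=
    { len := w.len - d
      f := skipAfter w.f i d
      hadj := by
        intro k hk
        rcases lt_or_ge k i with h | h
        · rw [hlo k (by omega), hlo (k + 1) (by omega)]
          exact w.hadj k (by omega)
        · rw [hhi k h, hhi (k + 1) (by omega), show k + 1 + d = k + d + 1 by omega]
          exact w.hadj (k + d) (by omega) }
  have ha' : w'.first = a := (hlo 0 (by omega)).trans ha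
  have hb' : w'.last = b := by
    refine Eq.trans (hhi (w.len - d) (by omega)) ?_
    rw [show w.len - d + d = w.len by omega]
    exact hb
  have hcol : ∀ k, 0 < k → k < w.len → w.ColliderAt k := fun k h0 h1 =>
    (hw.1 k h0 h1).resolve_left (Set.notMem_empty _)
  have hanc : ∀ k, 0 < k → k < w.len → w.f k ∈ G.ancSet ({a, b} ∪ S) := fun k h0 h1 => by
    have := hw.2 k h0 h1 (hcol k h0 h1)
    rwa [ha, hb] at this
  refine ih (w.len - d) (by omega) w' ha' hb' ⟨?_, ?_⟩ rfl
  · intro k h0 (hk : k < w.len - d)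
    right
    change G.mark (skipAfter w.f i d k) (skipAfter w.f i d (k - 1)) = _ ∧
      G.mark (skipAfter w.f i d k) (skipAfter w.f i d (k + 1)) = _
    rcases lt_trichotomy k i with h | h | h
    · rw [hlo k (by omega), hlo (k - 1) (by omega), hlo (k + 1) (by omega)]
      exact hcol k h0 (by omega)
    · rw [hhi (k + 1) (by omega), hlo (k - 1) (by omega), show k + 1 + d = k + d + 1 by omega]
      constructor
      · rw [hlo k (by omega)]
        exact (hcol k h0 (by omega)).1
      · rw [hhi k (by omega)]
        exact (hcol (k + d) (by omega) (by omega)).2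
    · rw [hhi k (by omega), hhi (k - 1) (by omega), hhi (k + 1) (by omega),
        show k + 1 + d = k + d + 1 by omega, show k - 1 + d = k + d - 1 by omega]
      exact hcol (k + d) (by omega) (by omega)
  · intro k h0 (hk : k < w.len - d) _
    rw [ha', hb']
    change skipAfter w.f i d k ∈ _
    rcases le_or_gt k i with h | h
    · rw [hlo k h]
      exact hanc k h0 (by omega)
    · rw [hhi k h.le]
      exact hanc (k + d) (by omega) (by omega)

/-- Distinct nodes `u`, `v` are joined by an `S`-inducing walk which has an arrowhead at
each of its endnodes that lies in `Z`. -/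
def Link (G : MixedGraph N) (S Z : Set N) (u v : N) : Prop :=
  u ≠ v ∧ ∃ w : GWalk G, w.first = u ∧ w.last = v ∧ G.InducingWalk ∅ S w ∧
    (u ∈ Z → G.mark (w.f 0) (w.f 1) = some Mark.arrow) ∧
    (v ∈ Z → G.mark (w.f w.len) (w.f (w.len - 1)) = some Mark.arrow)

theorem Link.inducingPathBtw {S Z : Set N} {u v : N} (h : G.Link S Z u v) :
    G.InducingPathBtw ∅ S u v :=
  let ⟨_, w, hu, hv, hw, _⟩ := h
  InducingWalkBtw.inducingPathBtw ⟨w, hu, hv, hw⟩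

theorem Link.len_pos {u v : N} (w : GWalk G) (hne : u ≠ v) (hu : w.first = u)
    (hv : w.last = v) : 0 < w.len := by
  rcases Nat.eq_zero_or_pos w.len with h | h
  · refine absurd ?_ hne
    rw [← hu, ← hv, GWalk.first, GWalk.last, h]
  · exact h

theorem Link.mem_nodes {S Z : Set N} {u v : N} (hG : G.WF) (h : G.Link S Z u v) :
    u ∈ G.nodes ∧ v ∈ G.nodes := by
  obtain ⟨hne, w, hu, hv, -⟩ := h
  have hpos := Link.len_pos w hne hu hv
  constructor
  · rw [← hu]
    exact (hG.2.2.2.2.2 _ _ (w.hadj 0 hpos)).1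
  · have := (hG.2.2.2.2.2 _ _ (w.hadj (w.len - 1) (by omega))).2
    rw [show w.len - 1 + 1 = w.len by omega] at this
    rw [← hv]
    exact this

/-- Links compose at a node of `Z` that is an ancestor of the outer nodes or of `S`. -/
theorem Link.trans {S Z : Set N} {u v x : N} (h₁ : G.Link S Z u v) (h₂ : G.Link S Z v x)
    (hux : u ≠ x) (hvZ : v ∈ Z) (hv : v ∈ G.ancSet ({u, x} ∪ S)) : G.Link S Z u x := by
  obtain ⟨hne₁, w₁, hu₁, hv₁, hi₁, ha₁, hb₁⟩ := h₁
  obtain ⟨hne₂, w₂, hu₂, hv₂, hi₂, ha₂, hb₂⟩ := h₂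
  have hp₁ := Link.len_pos w₁ hne₁ hu₁ hv₁
  have hp₂ := Link.len_pos w₂ hne₂ hu₂ hv₂
  set n := w₁.len with hn
  set m := w₂.len with hm
  have hglue : w₁.f n = w₂.f 0 := hv₁.trans hu₂.symm
  set g : ℕ → N := fun i => if i ≤ n then w₁.f i else w₂.f (i - n) with hg
  have hlo : ∀ i, i ≤ n → g i = w₁.f i := fun i h => if_pos h
  have hhi : ∀ i, g (n + i) = w₂.f i := by
    intro i
    rcases Nat.eq_zero_or_pos i with rfl | h
    · rw [Nat.add_zero, hlo n le_rfl, hglue]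
    · simp only [hg]
      rw [if_neg (by omega), show n + i - n = i by omega]
  have hadj : ∀ i < n + m, G.adj (g i) (g (i + 1)) := by
    intro i hi
    rcases lt_or_ge i n with h | h
    · rw [hlo i (by omega), hlo (i + 1) (by omega)]
      exact w₁.hadj i h
    · obtain ⟨k, rfl⟩ := Nat.exists_eq_add_of_le h
      rw [hhi k, add_assoc, hhi (k + 1)]
      exact w₂.hadj k (by omega)
  let w : GWalk G := ⟨n + m, g, hadj⟩
  have hfirst : w.first = u := (hlo 0 (by omega)).trans hu₁
  have hlast : w.last = x := (hhi m).trans hv₂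
  have hsub₁ : ∀ i, 0 < i → i < n → w₁.f i ∈ G.ancSet ({u, x} ∪ S) := by
    intro i h0 h1
    have := hi₁.2 i h0 h1 ((hi₁.1 i h0 h1).resolve_left (Set.notMem_empty _))
    rw [hu₁, hv₁, mem_ancSet_pair_union] at this
    rcases this with h | h | h
    · exact mem_ancSet_pair_union.2 (.inl h)
    · exact anc.mem_ancSet h hv
    · exact mem_ancSet_pair_union.2 (.inr (.inr h))
  have hsub₂ : ∀ i, 0 < i → i < m → w₂.f i ∈ G.ancSet ({u, x} ∪ S) := by
    intro i h0 h1
    have := hi₂.2 i h0 h1 ((hi₂.1 i h0 h1).resolve_left (Set.notMem_empty _))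
    rw [hu₂, hv₂, mem_ancSet_pair_union] at this
    rcases this with h | h | h
    · exact anc.mem_ancSet h hv
    · exact mem_ancSet_pair_union.2 (.inr (.inl h))
    · exact mem_ancSet_pair_union.2 (.inr (.inr h))
  refine ⟨hux, w, hfirst, hlast, ⟨?_, ?_⟩, ?_, ?_⟩
  · intro i h0 (h1 : i < n + m)
    right
    change G.mark (g i) (g (i - 1)) = _ ∧ G.mark (g i) (g (i + 1)) = _
    rcases lt_trichotomy i n with h | h | h
    · rw [hlo i (by omega), hlo (i - 1) (by omega), hlo (i + 1) (by omega)]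
      exact (hi₁.1 i h0 h).resolve_left (Set.notMem_empty _)
    · subst h
      rw [hhi 1, hlo (n - 1) (by omega)]
      refine ⟨?_, ?_⟩
      · rw [hlo n le_rfl]
        exact hb₁ hvZ
      · rw [hlo n le_rfl, hglue]
        exact ha₂ hvZ
    · obtain ⟨k, rfl⟩ := Nat.exists_eq_add_of_lt h
      rw [show n + k + 1 - 1 = n + k by omega, show n + k + 1 + 1 = n + (k + 2) by omega,
        show n + k + 1 = n + (k + 1) by omega, hhi, hhi, hhi]
      exact (hi₂.1 (k + 1) (by omega) (by omega)).resolve_left (Set.notMem_empty _)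
  · intro i h0 (h1 : i < n + m) _
    rw [hfirst, hlast]
    change g i ∈ _
    rcases lt_trichotomy i n with h | h | h
    · rw [hlo i h.le]
      exact hsub₁ i h0 h
    · subst h
      rw [hlo n le_rfl, show w₁.f n = v from hv₁]
      exact hv
    · obtain ⟨k, rfl⟩ := Nat.exists_eq_add_of_lt h
      rw [add_assoc, hhi]
      exact hsub₂ (k + 1) (by omega) (by omega)
  · intro hu
    change G.mark (g 0) (g 1) = _
    rw [hlo 0 (by omega), hlo 1 (by omega)]
    exact ha₁ hu
  · intro hx
    change G.mark (g (n + m)) (g (n + m - 1)) = _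
    rw [hhi m, show n + m - 1 = n + (m - 1) by omega, hhi]
    exact hb₂ hx

/-- A sequence of nodes `f 0, …, f n` in which consecutive nodes are linked and every
interior node lies in `Z`, in `Q`, or in the ancestors of its neighbours and `S`. -/
structure IsLinkChain (G : MixedGraph N) (S Z Q : Set N) (f : ℕ → N) (n : ℕ) : Prop where
  link : ∀ i < n, G.Link S Z (f i) (f (i + 1))
  interior : ∀ i, i + 1 < n →
    f (i + 1) ∈ Z ∨ f (i + 1) ∈ Q ∨ f (i + 1) ∈ G.ancSet ({f i, f (i + 2)} ∪ S)

/-- Replacing the neighbour `v` of `u` by the node `x` following `v` keeps `u` an ancestor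
of its neighbours and `S`. -/
theorem IsIADMG.mem_ancSet_of_skip (hG : G.IsIADMG) {S : Set N} {p u v x : N} (huv : u ≠ v)
    (hv : v ∈ G.ancSet ({u, x} ∪ S)) (hu : u ∈ G.ancSet ({p, v} ∪ S)) :
    u ∈ G.ancSet ({p, x} ∪ S) := by
  rw [mem_ancSet_pair_union] at *
  rcases hu with h | h | h
  · exact .inl h
  · rcases hv with h' | h' | h'
    · exact absurd (hG.anc_antisymm h h') huv
    · exact .inr (.inl (h.trans h'))
    · exact .inr (.inr (h.mem_ancSet h'))
  · exact .inr (.inr h)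

theorem IsLinkChain.skip_one (hG : G.IsIADMG) {S Z Q : Set N} {f : ℕ → N} {n i : ℕ}
    (h : G.IsLinkChain S Z Q f n) (hi : i + 1 < n) (hZ : f (i + 1) ∈ Z)
    (hanc : f (i + 1) ∈ G.ancSet ({f i, f (i + 2)} ∪ S)) (hne : f i ≠ f (i + 2)) :
    G.IsLinkChain S Z Q (skipAfter f i 1) (n - 1) := by
  have hlo : ∀ k, k ≤ i → skipAfter f i 1 k = f k := fun k => skipAfter_of_le _
  have hhi : ∀ k, i < k → skipAfter f i 1 k = f (k + 1) := fun k => skipAfter_of_lt _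
  constructor
  · intro k hk
    rcases lt_trichotomy k i with hki | rfl | hki
    · rw [hlo k (by omega), hlo (k + 1) (by omega)]
      exact h.link k (by omega)
    · rw [hlo k le_rfl, hhi (k + 1) (by omega)]
      exact (h.link k (by omega)).trans (h.link (k + 1) hi) hne hZ hanc
    · rw [hhi k hki, hhi (k + 1) (by omega)]
      exact h.link (k + 1) (by omega)
  · intro k hk
    rcases lt_or_ge (k + 1) i with hki | hki
    · rw [hlo k (by omega), hlo (k + 1) (by omega), hlo (k + 2) (by omega)]
      exact h.interior k (by omega)
    rcases hki.eq_or_lt with rfl | hki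
    · rw [hlo k (by omega), hlo (k + 1) (by omega), hhi (k + 2) (by omega)]
      exact (h.interior k (by omega)).imp id (Or.imp id
        (hG.mem_ancSet_of_skip (h.link (k + 1) (by omega)).1 hanc))
    rcases (Nat.lt_succ_iff.1 hki).eq_or_lt with rfl | hki'
    · rw [hlo i le_rfl, hhi (i + 1) (by omega), hhi (i + 2) (by omega)]
      refine (h.interior (i + 1) (by omega)).imp id (Or.imp id fun hx => ?_)
      rw [Set.pair_comm] at hx hanc ⊢
      exact hG.mem_ancSet_of_skip (h.link (i + 1) (by omega)).1.symm hanc hx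
    · rw [hhi k hki', hhi (k + 1) (by omega), hhi (k + 2) (by omega)]
      exact h.interior (k + 1) (by omega)

theorem IsLinkChain.skip_two (hG : G.IsIADMG) {S Z Q : Set N} {f : ℕ → N} {n i : ℕ}
    (h : G.IsLinkChain S Z Q f n) (hi : i + 1 < n)
    (hanc : f (i + 1) ∈ G.ancSet ({f i, f (i + 2)} ∪ S)) (heq : f i = f (i + 2)) :
    G.IsLinkChain S Z Q (skipAfter f i 2) (n - 2) := by
  have hlo : ∀ k, k ≤ i → skipAfter f i 2 k = f k := fun k => skipAfter_of_le _
  have hhi : ∀ k, i ≤ k → skipAfter f i 2 k = f (k + 2) := fun k => skipAfter_of_ge _ heq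
  constructor
  · intro k hk
    rcases lt_or_ge k i with hki | hki
    · rw [hlo k (by omega), hlo (k + 1) (by omega)]
      exact h.link k (by omega)
    · rw [hhi k hki, hhi (k + 1) (by omega)]
      exact h.link (k + 2) (by omega)
  · intro k hk
    rcases lt_trichotomy (k + 1) i with hki | rfl | hki
    · rw [hlo k (by omega), hlo (k + 1) (by omega), hlo (k + 2) (by omega)]
      exact h.interior k (by omega)
    · rw [hlo k (by omega), hlo (k + 1) (by omega), hhi (k + 2) (by omega)]
      refine (h.interior k (by omega)).imp id (Or.imp id fun hx => ?_)
      have := hG.mem_ancSet_of_skip (h.link (k + 1) (by omega)).1 hanc hx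
      rw [← heq] at hanc
      rw [mem_ancSet_pair_union] at hx hanc ⊢
      have hne := (h.link (k + 1) (by omega)).1
      rcases hx with hx | hx | hx
      · exact .inl hx
      · rcases hanc with h' | h' | h'
        · exact absurd (hG.anc_antisymm hx h') hne
        · exact absurd (hG.anc_antisymm hx h') hne
        · exact .inr (.inr (hx.mem_ancSet h'))
      · exact .inr (.inr hx)
    · rw [hhi k (by omega), hhi (k + 1) (by omega), hhi (k + 2) (by omega)]
      exact h.interior (k + 2) (by omega)

/-- Every link chain can be shortened to one in which no interior node of `Z` is an
ancestor of its neighbours or `S`. -/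
theorem IsLinkChain.exists_irreducible (hG : G.IsIADMG) {S Z Q T I : Set N} {f : ℕ → N}
    {n : ℕ} (h : G.IsLinkChain S Z Q f n) (hT : ∀ i ≤ n, f i ∉ T) (hI : ∀ i < n, f i ∉ I) :
    ∃ g m, G.IsLinkChain S Z Q g m ∧ g 0 = f 0 ∧ g m = f n ∧ (∀ i ≤ m, g i ∉ T) ∧
      (∀ i < m, g i ∉ I) ∧
      ∀ i, i + 1 < m → g (i + 1) ∈ Z → g (i + 1) ∉ G.ancSet ({g i, g (i + 2)} ∪ S) := by
  induction n using Nat.strong_induction_on generalizing f with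
  | _ n ih =>
  by_cases hred : ∀ i, i + 1 < n → f (i + 1) ∈ Z →
      f (i + 1) ∉ G.ancSet ({f i, f (i + 2)} ∪ S)
  · exact ⟨f, n, h, rfl, rfl, hT, hI, hred⟩
  push Not at hred
  obtain ⟨i, hi, hZ, hanc⟩ := hred
  have hlo : ∀ d k, k ≤ i → skipAfter f i d k = f k := fun d k => skipAfter_of_le _
  have hhi : ∀ d k, i < k → skipAfter f i d k = f (k + d) := fun d k => skipAfter_of_lt _
  have key : ∀ d, 0 < d → d ≤ n → G.IsLinkChain S Z Q (skipAfter f i d) (n - d) →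
      skipAfter f i d (n - d) = f n → ∃ g m, G.IsLinkChain S Z Q g m ∧ g 0 = f 0 ∧
      g m = f n ∧ (∀ i ≤ m, g i ∉ T) ∧ (∀ i < m, g i ∉ I) ∧
      ∀ i, i + 1 < m → g (i + 1) ∈ Z → g (i + 1) ∉ G.ancSet ({g i, g (i + 2)} ∪ S) := by
    intro d hd hdn hch hend
    rw [← hend, ← hlo d 0 (Nat.zero_le _)]
    refine ih (n - d) (by omega) hch ?_ ?_
    · intro k hk
      rcases le_or_gt k i with hki | hki
      · rw [hlo d k hki]
        exact hT k (by omega)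
      · rw [hhi d k hki]
        exact hT (k + d) (by omega)
    · intro k hk
      rcases le_or_gt k i with hki | hki
      · rw [hlo d k hki]
        exact hI k (by omega)
      · rw [hhi d k hki]
        exact hI (k + d) (by omega)
  by_cases heq : f i = f (i + 2)
  · refine key 2 (by omega) (by omega) (h.skip_two hG hi hanc heq) ?_
    rw [skipAfter_of_ge f heq (by omega), show n - 2 + 2 = n by omega]
  · refine key 1 (by omega) (by omega) (h.skip_one hG hi hZ hanc heq) ?_
    rw [hhi 1 _ (by omega), show n - 1 + 1 = n by omega]

theorem admgHardManip_mark {T : Set N} {a b : N} {m : Mark}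
    (h : (admgHardManip G T).mark a b = some m) : G.mark a b = some m := by
  simp only [admgHardManip] at h
  split_ifs at h
  exact h

theorem admgHardManip_adj {T : Set N} {a b : N} (h : (admgHardManip G T).adj a b) :
    G.adj a b := by
  obtain ⟨m, hm⟩ := Option.isSome_iff_exists.1 h
  exact adj_of_mark (admgHardManip_mark hm)

theorem admgHardManip_mark_of_adj {T : Set N} {a b : N} (h : (admgHardManip G T).adj a b) :
    (admgHardManip G T).mark a b = G.mark a b := by
  obtain ⟨m, hm⟩ := Option.isSome_iff_exists.1 h
  rw [hm, admgHardManip_mark hm]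

theorem admgHardManip_notMem_of_arrow {T : Set N} {a b : N}
    (h : (admgHardManip G T).mark a b = some Mark.arrow) : a ∉ T := by
  intro ha
  have := admgHardManip_mark h
  simp [admgHardManip, ha, this] at h

theorem admgHardManip_adj_symm (hG : G.WF) {T : Set N} {a b : N}
    (h : (admgHardManip G T).adj a b) : (admgHardManip G T).adj b a := by
  have := hG.adj_symm (admgHardManip_adj h)
  simp only [adj, admgHardManip] at h this ⊢
  split_ifs at h with h'
  · simp at h
  · rw [if_neg fun h => h' h.symm]
    exact this

theorem magHardManip_mark {T : Set N} {a b : N} {m : Mark}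
    (h : (magHardManip G T).mark a b = some m) : G.mark a b = some m := by
  simp only [magHardManip] at h
  split_ifs at h
  exact h

theorem magHardManip_mark_eq {T : Set N} {a b : N} (ha : a ∉ T) (hb : b ∉ T)
    (hab : ¬ (a ∈ G.inputs ∧ b ∈ G.inputs)) : (magHardManip G T).mark a b = G.mark a b := by
  simp only [magHardManip]
  rw [if_neg (by tauto)]

end MixedGraph

namespace RepresentsS

open MixedGraph

variable {N : Type} {M : MixedGraph N} {A : SADMG N}

theorem mem_nodes (hR : RepresentsS M A) {a : N} (ha : a ∈ A.graph.nodes) (hS : a ∉ A.sel) :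
    a ∈ M.nodes := by
  rcases ha with ha | ha
  · exact .inl (hR.1 ▸ ha)
  · exact .inr (hR.2.1 ▸ ⟨ha, hS⟩)

/-- In an iMAG, the mark at `a` towards an adjacent `b` is an arrowhead unless `a` is an
ancestor of `b` or of the selection nodes. -/
theorem mark_eq_arrow (hM : M.IsIMAG) (hR : RepresentsS M A) {a b : N} (hab : M.adj a b)
    (h : a ∉ A.graph.ancSet ({b} ∪ A.sel)) : M.mark a b = some Mark.arrow := by
  obtain ⟨m, hm⟩ := Option.isSome_iff_exists.1 hab
  cases m with
  | arrow => exact hm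
  | tail => exact absurd (hR.2.2.2.2 a b hm) h
  | circle => exact absurd hm (hM.2 a b)

theorem mark_eq_tail (hM : M.IsIMAG) (hR : RepresentsS M A) {a b : N} (hab : M.adj a b)
    (h : a ∈ A.graph.ancSet ({b} ∪ A.sel)) : M.mark a b = some Mark.tail := by
  obtain ⟨m, hm⟩ := Option.isSome_iff_exists.1 hab
  cases m with
  | tail => exact hm
  | arrow => exact absurd h (hR.2.2.2.1 a b hm)
  | circle => exact absurd hm (hM.2 a b)

theorem mem_ancSet_of_admgHardManip (hM : M.IsIMAG) (hA : A.WF) (hR : RepresentsS M A)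
    {C T : Set N} {a : N} (h : a ∈ (admgHardManip A.graph T).ancSet (C ∪ T ∪ A.sel)) :
    a ∈ (magHardManip M T).ancSet (C ∪ T) ∨ a ∈ A.graph.ancSet A.sel := by
  obtain ⟨z, hz, haz⟩ := h
  induction haz using Relation.ReflTransGen.head_induction_on with
  | refl => exact hz.imp (fun h => subset_ancSet _ h) (fun h => subset_ancSet _ h)
  | @head a b hab _ ih =>
    have hdir : A.graph.dir a b := ⟨admgHardManip_mark hab.1, admgHardManip_mark hab.2⟩
    by_cases hbS : b ∈ A.graph.ancSet A.sel
    · exact .inr (anc.mem_ancSet (.single hdir) hbS)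
    by_cases haS : a ∈ A.sel
    · exact .inr (subset_ancSet _ haS)
    have hbT := admgHardManip_notMem_of_arrow hab.2
    have hadj := adj_of_mark hdir.1
    have hne := hA.1.1.ne_of_adj hadj
    have hn := hA.1.1.2.2.2.2.2 a b hadj
    have hbI : b ∉ M.inputs := fun h => hA.1.2.2.2.1 b (hR.1 ▸ h) a hdir.2
    have hMadj : M.adj a b :=
      (hR.2.2.1 a b hne (hR.mem_nodes hn.1 haS)
        (hR.mem_nodes hn.2 fun h => hbS (subset_ancSet _ h))).2
        ⟨fun h => hbI h.2, InducingWalkBtw.inducingPathBtw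
          ⟨edgeWalk hadj, rfl, rfl, inducingWalk_edgeWalk hadj _ _⟩⟩
    have hab' : M.mark a b = some Mark.tail :=
      hR.mark_eq_tail hM hMadj (mem_ancSet_singleton_union.2 (.inl (.single hdir)))
    have hba' : M.mark b a = some Mark.arrow := by
      refine hR.mark_eq_arrow hM (hM.1.1.adj_symm hMadj) fun h => ?_
      rcases mem_ancSet_singleton_union.1 h with h | h
      · exact hA.1.2.2.1 a b hdir h
      · exact hbS h
    have hdir' : (magHardManip M T).dir a b := by
      constructor
      · simp only [magHardManip]
        rw [if_neg (by simp_all)]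
        exact hab'
      · simp only [magHardManip]
        rw [if_neg (by simp_all)]
        exact hba'
    exact .inl (anc.mem_ancSet (.single hdir') (ih.resolve_right hbS))

/-- Open walks in a manipulated isADMG give open walks in the manipulated iMAG. -/
theorem idSepSimple_admgHardManip (hM : M.IsIMAG) (hA : A.WF) (hR : RepresentsS M A)
    {X B C T : Set N} (hX : X ⊆ M.outputs \ T) (hXB : Disjoint X B)
    (hsep : IdSepSimple (magHardManip M T) X B (C ∪ T)) :
    IdSepSimple (admgHardManip A.graph T) X B (C ∪ T ∪ A.sel) := by
  intro w hfirst hlast ⟨ho₁, ho₂, ho⟩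
  have hG := hA.1
  set Z := C ∪ A.sel with hZ
  set Q := (magHardManip M T).ancSet (C ∪ T) with hQ
  have hinput : ∀ a ∈ M.inputs, ∀ b, A.graph.mark a b ≠ some Mark.arrow :=
    fun a ha => hG.2.2.2.1 a (hR.1 ▸ ha)
  have hX0 : w.f 0 ∉ M.inputs := fun h => hM.1.1.1.le_bot ⟨h, (hX hfirst).1⟩
  have hcollider : ∀ i, 0 < i → i < w.len → w.f i ∈ C ∪ T ∪ A.sel → w.ColliderAt i :=
    fun i h0 h1 h => by_contra fun hc => (ho i h0 h1).1 hc h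
  have hnotT : ∀ i ≤ w.len, w.f i ∉ T := by
    intro i hi h
    rcases Nat.eq_zero_or_pos i with rfl | h0
    · exact ho₁ (.inl (.inr h))
    rcases hi.eq_or_lt with rfl | h1
    · exact ho₂ (.inl (.inr h))
    exact admgHardManip_notMem_of_arrow (hcollider i h0 h1 (.inl (.inr h))).1 h
  have hex : ∃ m, m = w.len ∨ w.f m ∈ M.inputs := ⟨_, .inl rfl⟩
  set m := Nat.find hex with hm
  have hmlen : m ≤ w.len := Nat.find_min' hex (.inl rfl)
  have hmI : ∀ i < m, w.f i ∉ M.inputs := fun i hi h => Nat.find_min hex hi (.inr h)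
  have hmlast : w.f m ∈ B ∪ M.inputs := by
    rcases Nat.find_spec hex with h | h
    · rw [← hm] at h
      rw [h]
      rcases hlast with hl | hl | hl
      · exact .inl hl
      · exact .inr (hR.1.symm ▸ hl)
      · exact absurd hl.1 (hnotT w.len le_rfl)
    · exact .inr h
  have hZsub : ∀ {a}, a ∈ Z → a ∈ C ∪ T ∪ A.sel :=
    fun h => h.elim (fun h => .inl (.inl h)) (fun h => .inr h)
  have hm0 : w.f 0 ∉ Z := fun h => ho₁ (hZsub h)
  have hmZ : w.f m ∉ Z := by
    intro h
    rcases hmlen.eq_or_lt with heq | hlt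
    · rw [heq] at h
      exact ho₂ (hZsub h)
    have hmem : w.f m ∈ M.inputs := (Nat.find_spec hex).resolve_left hlt.ne
    have hpos : 0 < m := Nat.pos_of_ne_zero fun h0 => hX0 (h0 ▸ hmem)
    exact hinput _ hmem _ (admgHardManip_mark (hcollider m hpos hlt (hZsub h)).1)
  have hne0m : w.f 0 ≠ w.f m := by
    intro h
    rcases hmlast with hb | hi
    · exact Set.disjoint_left.1 hXB hfirst (h ▸ hb : w.f 0 ∈ B)
    · exact hX0 (h ▸ hi)
  have hZcol : ∀ i ≤ m, w.f i ∈ Z → 0 < i ∧ i < m ∧ w.ColliderAt i := by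
    intro i hi h
    have h0 : 0 < i := Nat.pos_of_ne_zero fun h0 => hm0 (h0 ▸ h)
    have h1 : i < m := lt_of_le_of_ne hi fun h1 => hmZ (h1 ▸ h)
    exact ⟨h0, h1, hcollider i h0 (by omega) (hZsub h)⟩
  have hchain : A.graph.IsLinkChain A.sel Z Q w.f m := by
    constructor
    · intro i hi
      have hadj := admgHardManip_adj (w.hadj i (by omega))
      refine ⟨hG.1.ne_of_adj hadj, edgeWalk hadj, rfl, rfl, inducingWalk_edgeWalk _ _ _, ?_, ?_⟩
      · intro h
        exact admgHardManip_mark (hZcol i hi.le h).2.2.2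
      · intro h
        exact admgHardManip_mark (hZcol (i + 1) hi h).2.2.1
    · intro i hi
      by_cases hc : w.ColliderAt (i + 1)
      · right
        refine (hR.mem_ancSet_of_admgHardManip hM hA
          ((ho (i + 1) (by omega) (by omega)).2 hc)).imp id fun h => ?_
        exact mem_ancSet_pair_union.2 (.inr (.inr h))
      · right; right
        rw [mem_ancSet_pair_union]
        have h1 := admgHardManip_adj_symm hG.1 (w.hadj i (by omega))
        have h2 := w.hadj (i + 1) (by omega)
        simp only [GWalk.ColliderAt, Nat.add_sub_cancel, admgHardManip_mark_of_adj h1,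
          admgHardManip_mark_of_adj h2] at hc
        by_cases hc1 : A.graph.mark (w.f (i + 1)) (w.f i) = some Mark.arrow
        · exact .inr (.inl (.single
            (hG.dir_of_adj (admgHardManip_adj h2) fun hc2 => hc ⟨hc1, hc2⟩)))
        · exact .inl (.single (hG.dir_of_adj (admgHardManip_adj h1) hc1))
  obtain ⟨g, n, hg, hg0, hgn, hgT, hgI, hirr⟩ :=
    hchain.exists_irreducible hG (fun i hi => hnotT i (hi.trans hmlen)) hmI
  have hnpos : 0 < n := Nat.pos_of_ne_zero fun h => hne0m (by rw [← hg0, ← hgn, h])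
  have hgS : ∀ i ≤ n, g i ∉ A.sel := by
    intro i hi h
    rcases Nat.eq_zero_or_pos i with rfl | h0
    · exact hm0 (hg0 ▸ .inr h)
    rcases hi.eq_or_lt with rfl | h1
    · exact hmZ (hgn ▸ .inr h)
    obtain ⟨k, rfl⟩ := Nat.exists_eq_add_of_lt h0
    rw [Nat.zero_add] at *
    exact hirr k h1 (.inr h) (mem_ancSet_pair_union.2 (.inr (.inr (subset_ancSet _ h))))
  have hMadj : ∀ i < n, M.adj (g i) (g (i + 1)) := by
    intro i hi
    have hl := hg.link i hi
    have hn := hl.mem_nodes hG.1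
    exact (hR.2.2.1 _ _ hl.1 (hR.mem_nodes hn.1 (hgS i hi.le))
      (hR.mem_nodes hn.2 (hgS (i + 1) hi))).2 ⟨fun h => hgI i hi h.1, hl.inducingPathBtw⟩
  have hmark : ∀ i < n, (magHardManip M T).mark (g i) (g (i + 1)) = M.mark (g i) (g (i + 1)) :=
    fun i hi => magHardManip_mark_eq (hgT i hi.le) (hgT (i + 1) hi) fun h => hgI i hi h.1
  have hmark' : ∀ i < n,
      (magHardManip M T).mark (g (i + 1)) (g i) = M.mark (g (i + 1)) (g i) :=
    fun i hi => magHardManip_mark_eq (hgT (i + 1) hi) (hgT i hi.le) fun h => hgI i hi h.2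
  let v : GWalk (magHardManip M T) :=
    ⟨n, g, fun i hi => by rw [adj, hmark i hi]; exact hMadj i hi⟩
  refine hsep v ?_ ?_ ⟨?_, ?_, ?_⟩
  · change g 0 ∈ X
    rw [hg0]
    exact hfirst
  · change g n ∈ B ∪ (magHardManip M T).inputs
    rw [hgn]
    exact hmlast.imp id fun h => .inl h
  · change g 0 ∉ C ∪ T
    rintro (h | h)
    · exact hm0 (hg0 ▸ .inl h)
    · exact hgT 0 (Nat.zero_le _) h
  · change g n ∉ C ∪ T
    rintro (h | h)
    · exact hmZ (hgn ▸ .inl h)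
    · exact hgT n le_rfl h
  · intro i h0 (h1 : i < n)
    obtain ⟨k, rfl⟩ := Nat.exists_eq_add_of_lt h0
    rw [Nat.zero_add] at *
    have hcol : v.ColliderAt (k + 1) ↔ M.mark (g (k + 1)) (g k) = some Mark.arrow ∧
        M.mark (g (k + 1)) (g (k + 2)) = some Mark.arrow := by
      rw [← hmark' k (by omega), ← hmark (k + 1) h1]
      rfl
    constructor
    · rintro hnc (hC | hT)
      · have hn := hirr k h1 (.inl hC)
        refine hnc (hcol.2 ⟨hR.mark_eq_arrow hM (hM.1.1.adj_symm (hMadj k (by omega))) ?_,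
          hR.mark_eq_arrow hM (hMadj (k + 1) h1) ?_⟩)
        · exact fun h => hn (ancSet_mono (Set.union_subset_union_left _ (by simp)) h)
        · exact fun h => hn (ancSet_mono (Set.union_subset_union_left _ (by simp)) h)
      · exact hgT (k + 1) h1.le hT
    · intro hc
      rcases hg.interior k h1 with h | h | h
      · exact subset_ancSet _ (.inl (h.resolve_right (hgS (k + 1) h1.le)))
      · exact h
      · obtain ⟨hc1, hc2⟩ := hcol.1 hc
        have hc1 := hR.2.2.2.1 _ _ hc1
        have hc2 := hR.2.2.2.1 _ _ hc2
        rw [mem_ancSet_singleton_union] at hc1 hc2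
        rw [mem_ancSet_pair_union] at h
        tauto

end RepresentsS

namespace MixedGraph

variable {N : Type} {G M : MixedGraph N}

theorem Link.of_adj (hG : G.WF) {S Z : Set N} {u v : N} (h : G.adj u v)
    (hu : u ∈ Z → G.mark u v = some Mark.arrow) (hv : v ∈ Z → G.mark v u = some Mark.arrow) :
    G.Link S Z u v :=
  ⟨hG.ne_of_adj h, edgeWalk h, rfl, rfl, inducingWalk_edgeWalk h _ _, hu, hv⟩

/-- Directed edges of the canonical isADMG: those of `M`, and for every undirected edge
`a − b` of `M` the edges from `a` and `b` to the selection node `σ s(a, b)`. -/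
def selDir (M : MixedGraph N) (σ : Sym2 N → N) (x y : N) : Prop :=
  M.dir x y ∨ ∃ b, M.undir x b ∧ y = σ s(x, b)

/-- The canonical isADMG of an iMAG `M`: each undirected edge `a − b` is replaced by
`a → s ← b` for its own selection node `s = σ s(a, b)`. -/
def canonicalSADMG (M : MixedGraph N) (σ : Sym2 N → N) : SADMG N where
  graph :=
    { inputs := M.inputs
      outputs := M.outputs ∪ {s | ∃ a b, M.undir a b ∧ s = σ s(a, b)}
      mark := fun x y =>
        if M.selDir σ x y then some Mark.tail
        else if M.selDir σ y x ∨ M.bidir x y then some Mark.arrow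
        else none }
  sel := {s | ∃ a b, M.undir a b ∧ s = σ s(a, b)}

/-- `σ` assigns to the undirected edges of `M` distinct fresh nodes. -/
structure FreshNodes (M : MixedGraph N) (σ : Sym2 N → N) : Prop where
  notMem : ∀ a b, M.undir a b → σ s(a, b) ∉ M.nodes
  inj : ∀ a b c d, M.undir a b → M.undir c d → σ s(a, b) = σ s(c, d) → s(a, b) = s(c, d)

theorem undir.symm {a b : N} (h : M.undir a b) : M.undir b a := ⟨h.2, h.1⟩

theorem bidir.symm {a b : N} (h : M.bidir a b) : M.bidir b a := ⟨h.2, h.1⟩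

theorem WF.mem_nodes_of_mark (hM : M.WF) {a b : N} {m : Mark} (h : M.mark a b = some m) :
    a ∈ M.nodes ∧ b ∈ M.nodes := hM.2.2.2.2.2 a b (adj_of_mark h)

theorem exists_freshNodes [Infinite N] (hM : M.WF) : ∃ σ, M.FreshNodes σ := by
  have hfin : M.nodes.Finite := hM.2.1.union hM.2.2.1
  set D : Set (Sym2 N) := (fun p : N × N => s(p.1, p.2)) '' (M.nodes ×ˢ M.nodes) with hD
  have hDfin : D.Finite := (hfin.prod hfin).image _
  have hmem : ∀ a b, M.undir a b → s(a, b) ∈ D := fun a b h =>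
    ⟨(a, b), hM.mem_nodes_of_mark h.1, rfl⟩
  obtain ⟨σ, hσ, hinj⟩ := hDfin.exists_injOn_of_encard_le (t := M.nodesᶜ)
    (by rw [hfin.infinite_compl.encard_eq]; exact le_top)
  exact ⟨σ, fun a b h => hσ (hmem a b h),
    fun a b c d h h' he => hinj (hmem a b h) (hmem c d h') he⟩

theorem WF.mem_nodes_of_selDir (hM : M.WF) {σ : Sym2 N → N} {x y : N}
    (h : M.selDir σ x y) : x ∈ M.nodes := by
  rcases h with h | ⟨b, h, -⟩
  · exact (hM.mem_nodes_of_mark h.1).1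
  · exact (hM.mem_nodes_of_mark h.1).1

theorem FreshNodes.dir_of_selDir {σ : Sym2 N → N} (hσ : M.FreshNodes σ) {x y : N}
    (h : M.selDir σ x y) (hy : y ∈ M.nodes) : M.dir x y := by
  rcases h with h | ⟨b, h, rfl⟩
  · exact h
  · exact absurd hy (hσ.notMem x b h)

theorem FreshNodes.not_selDir_symm {σ : Sym2 N → N} (hσ : M.FreshNodes σ) (hM : M.WF)
    {x y : N} (h : M.selDir σ x y) : ¬ M.selDir σ y x := by
  intro h'
  have h1 := hσ.dir_of_selDir h (hM.mem_nodes_of_selDir h')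
  have h2 := hσ.dir_of_selDir h' (hM.mem_nodes_of_selDir h)
  simpa [h1.1] using h2.2

theorem FreshNodes.not_bidir_of_selDir {σ : Sym2 N → N} (hσ : M.FreshNodes σ) (hM : M.WF)
    {x y : N} (h : M.selDir σ x y) : ¬ M.bidir x y := by
  intro h'
  have h1 := hσ.dir_of_selDir h (hM.mem_nodes_of_mark h'.1).2
  simpa [h1.1] using h'.1

theorem canonicalSADMG_mark_tail {σ : Sym2 N → N} {x y : N} :
    (M.canonicalSADMG σ).graph.mark x y = some Mark.tail ↔ M.selDir σ x y := by
  simp only [canonicalSADMG]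
  split_ifs <;> simp_all

theorem FreshNodes.mark_arrow {σ : Sym2 N → N} (hσ : M.FreshNodes σ) (hM : M.WF) {x y : N} :
    (M.canonicalSADMG σ).graph.mark x y = some Mark.arrow ↔
      M.selDir σ y x ∨ M.bidir x y := by
  have h1 := @FreshNodes.not_selDir_symm N M σ hσ hM x y
  have h2 := @FreshNodes.not_bidir_of_selDir N M σ hσ hM x y
  simp only [canonicalSADMG]
  split_ifs <;> simp_all

theorem canonicalSADMG_adj {σ : Sym2 N → N} {x y : N} :
    (M.canonicalSADMG σ).graph.adj x y ↔
      M.selDir σ x y ∨ M.selDir σ y x ∨ M.bidir x y := by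
  simp only [adj, canonicalSADMG]
  split_ifs <;> simp_all

theorem FreshNodes.dir_iff {σ : Sym2 N → N} (hσ : M.FreshNodes σ) (hM : M.WF) {x y : N} :
    (M.canonicalSADMG σ).graph.dir x y ↔ M.selDir σ x y := by
  rw [dir, canonicalSADMG_mark_tail, hσ.mark_arrow hM]
  exact and_iff_left_of_imp .inl

theorem FreshNodes.anc_of_anc {σ : Sym2 N → N} (hσ : M.FreshNodes σ) (hM : M.WF) {a b : N}
    (h : (M.canonicalSADMG σ).graph.anc a b) (hb : b ∈ M.nodes) : M.anc a b := by
  induction h using Relation.ReflTransGen.head_induction_on with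
  | refl => exact .refl
  | @head a c hac _ ih =>
    have hc : c ∈ M.nodes := by
      rcases Relation.ReflTransGen.cases_head ih with rfl | ⟨d, hd, -⟩
      · exact hb
      · exact (hM.mem_nodes_of_mark hd.1).1
    exact ih.head (hσ.dir_of_selDir ((hσ.dir_iff hM).1 hac) hc)

theorem FreshNodes.exists_undir_of_anc {σ : Sym2 N → N} (hσ : M.FreshNodes σ) (hM : M.WF)
    {a s : N} (h : (M.canonicalSADMG σ).graph.anc a s) (hs : s ∉ M.nodes) :
    a = s ∨ ∃ c d, M.anc a c ∧ M.undir c d := by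
  induction h using Relation.ReflTransGen.head_induction_on with
  | refl => exact .inl rfl
  | @head a c hac _ ih =>
    right
    rcases (hσ.dir_iff hM).1 hac with h | ⟨b, h, -⟩
    · rcases ih with rfl | ⟨c', d, hc, hd⟩
      · exact absurd (hM.mem_nodes_of_mark h.1).2 hs
      · exact ⟨c', d, hc.head h, hd⟩
    · exact ⟨a, b, .refl, h⟩

theorem FreshNodes.sel_notMem {σ : Sym2 N → N} (hσ : M.FreshNodes σ) {s : N}
    (hs : s ∈ (M.canonicalSADMG σ).sel) : s ∉ M.nodes := by
  obtain ⟨a, b, h, rfl⟩ := hs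
  exact hσ.notMem a b h

/-- Nodes of an iMAG carrying an arrowhead are not ancestors of selection nodes. -/
theorem FreshNodes.notMem_ancSet_sel {σ : Sym2 N → N} (hσ : M.FreshNodes σ) (hM : M.IsIPAG)
    {a b : N} (h : M.mark a b = some Mark.arrow) :
    a ∉ (M.canonicalSADMG σ).graph.ancSet (M.canonicalSADMG σ).sel := by
  rintro ⟨s, hs, has⟩
  rcases hσ.exists_undir_of_anc hM.1 has (hσ.sel_notMem hs) with rfl | ⟨c, d, hc, hd⟩
  · exact hσ.sel_notMem hs (hM.1.mem_nodes_of_mark h).1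
  · rcases Relation.ReflTransGen.cases_tail hc with rfl | ⟨e, -, he⟩
    · exact hM.2.2.2.2.2.1 _ _ d h hd
    · exact hM.2.2.2.2.2.1 e c d he.2 hd

theorem FreshNodes.canonicalSADMG_wf {σ : Sym2 N → N} (hσ : M.FreshNodes σ)
    (hM : M.IsIPAG) : (M.canonicalSADMG σ).WF := by
  obtain ⟨hwf, harr, hII, hacyc, -⟩ := hM
  have hselfin : (M.canonicalSADMG σ).sel.Finite := by
    have hfin : M.nodes.Finite := hwf.2.1.union hwf.2.2.1
    refine ((hfin.prod hfin).image fun p : N × N => σ s(p.1, p.2)).subset ?_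
    rintro _ ⟨a, b, h, rfl⟩
    exact ⟨(a, b), hwf.mem_nodes_of_mark h.1, rfl⟩
  have hnodes : ∀ x y, M.selDir σ x y →
      x ∈ (M.canonicalSADMG σ).graph.nodes ∧ y ∈ (M.canonicalSADMG σ).graph.nodes := by
    have hsub : M.nodes ⊆ (M.canonicalSADMG σ).graph.nodes :=
      Set.union_subset_union_right _ Set.subset_union_left
    intro x y h
    refine ⟨hsub (hwf.mem_nodes_of_selDir h), ?_⟩
    rcases h with h | ⟨b, h, rfl⟩
    · exact hsub (hwf.mem_nodes_of_mark h.2).1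
    · exact .inr (.inr ⟨x, b, h, rfl⟩)
  refine ⟨⟨⟨?_, hwf.2.1, hwf.2.2.1.union hselfin, ?_, ?_, ?_⟩, ?_, ?_, ?_, ?_⟩,
    Set.subset_union_right⟩
  · refine Set.disjoint_union_right.2 ⟨hwf.1, Set.disjoint_left.2 fun a ha hs => ?_⟩
    exact hσ.sel_notMem hs (.inl ha)
  · intro a b h
    have h := canonicalSADMG_adj.1 h
    exact canonicalSADMG_adj.2
      (h.elim (fun h => .inr (.inl h)) (Or.imp id fun h => .inr h.symm))
  · intro a
    rw [← Option.not_isSome_iff_eq_none]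
    intro h
    have hbi : ¬ M.bidir a a := fun h => hwf.ne_of_adj (adj_of_mark h.1) rfl
    rcases canonicalSADMG_adj.1 h with h | h | h
    · exact hσ.not_selDir_symm hwf h h
    · exact hσ.not_selDir_symm hwf h h
    · exact hbi h
  · intro a b h
    rcases canonicalSADMG_adj.1 h with h | h | h
    · exact hnodes a b h
    · exact (hnodes b a h).symm
    · exact (hwf.mem_nodes_of_mark h.1).imp (Or.imp id .inl) (Or.imp id .inl)
  · intro a b h
    rw [hσ.dir_iff hwf, hσ.dir_iff hwf, bidir, hσ.mark_arrow hwf, hσ.mark_arrow hwf]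
    rcases canonicalSADMG_adj.1 h with h | h | h
    · exact .inl h
    · exact .inr (.inl h)
    · exact .inr (.inr ⟨.inr h, .inr h.symm⟩)
  · intro a b h h'
    rw [hσ.dir_iff hwf] at h
    have hanc := hσ.anc_of_anc hwf h' (hwf.mem_nodes_of_selDir h)
    rcases h with h | ⟨c, h, rfl⟩
    · exact hacyc a b h hanc
    · have ha := (hwf.mem_nodes_of_mark h.1).1
      rcases Relation.ReflTransGen.cases_head hanc with he | ⟨d, hd, -⟩
      · exact hσ.notMem a c h (by rw [he]; exact ha)
      · exact hσ.notMem a c h (hwf.mem_nodes_of_mark hd.1).1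
  · intro a ha b h
    rcases (hσ.mark_arrow hwf).1 h with h | h
    · exact harr a ha b (hσ.dir_of_selDir h (.inl ha)).2
    · exact harr a ha b h.1
  · intro a ha b hb h
    rcases canonicalSADMG_adj.1 h with h | h | h
    · exact hII a ha b hb (adj_of_mark (hσ.dir_of_selDir h (.inl hb)).1)
    · exact hII a ha b hb (adj_of_mark (hσ.dir_of_selDir h (.inl ha)).2)
    · exact hII a ha b hb (adj_of_mark h.1)

theorem IsIMAG.edge_cases (hM : M.IsIMAG) {a b : N} (h : M.adj a b) :
    M.dir a b ∨ M.dir b a ∨ M.bidir a b ∨ M.undir a b := by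
  obtain ⟨m, hm⟩ := Option.isSome_iff_exists.1 h
  obtain ⟨m', hm'⟩ := Option.isSome_iff_exists.1 (hM.1.1.adj_symm h)
  have h1 := hM.2 a b
  have h2 := hM.2 b a
  cases m <;> cases m' <;> simp_all [dir, bidir, undir]

theorem FreshNodes.inducingPathBtw_of_adj {σ : Sym2 N → N} (hσ : M.FreshNodes σ)
    (hM : M.IsIMAG) {a b : N} (h : M.adj a b) :
    (M.canonicalSADMG σ).graph.InducingPathBtw ∅ (M.canonicalSADMG σ).sel a b := by
  have hwf := hM.1.1
  have hA := hσ.canonicalSADMG_wf hM.1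
  have hn := hwf.2.2.2.2.2 a b h
  have hlink : M.selDir σ a b ∨ M.selDir σ b a ∨ M.bidir a b →
      (M.canonicalSADMG σ).graph.Link (M.canonicalSADMG σ).sel (M.canonicalSADMG σ).sel a b :=
    fun h => Link.of_adj hA.1.1 (canonicalSADMG_adj.2 h)
      (fun hs => absurd hn.1 (hσ.sel_notMem hs)) (fun hs => absurd hn.2 (hσ.sel_notMem hs))
  refine Link.inducingPathBtw (Z := (M.canonicalSADMG σ).sel) ?_
  rcases hM.edge_cases h with h | h | h | h
  · exact hlink (.inl (.inl h))
  · exact hlink (.inr (.inl (.inl h)))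
  · exact hlink (.inr (.inr h))
  · have hs : σ s(a, b) ∈ (M.canonicalSADMG σ).sel := ⟨a, b, h, rfl⟩
    have hda : M.selDir σ a (σ s(a, b)) := .inr ⟨b, h, rfl⟩
    have hdb : M.selDir σ b (σ s(a, b)) := .inr ⟨a, h.symm, by rw [Sym2.eq_swap]⟩
    refine Link.trans (v := σ s(a, b))
      (Link.of_adj hA.1.1 (canonicalSADMG_adj.2 (.inl hda))
        (fun hs => absurd hn.1 (hσ.sel_notMem hs))
        (fun _ => (hσ.mark_arrow hwf).2 (.inl hda)))
      (Link.of_adj hA.1.1 (canonicalSADMG_adj.2 (.inr (.inl hdb)))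
        (fun _ => (hσ.mark_arrow hwf).2 (.inl hdb))
        (fun hs => absurd hn.2 (hσ.sel_notMem hs)))
      (hwf.ne_of_adj (adj_of_mark h.1)) hs ?_
    exact mem_ancSet_pair_union.2 (.inr (.inr (subset_ancSet _ hs)))

theorem FreshNodes.adj_of_inducingPathBtw {σ : Sym2 N → N} (hσ : M.FreshNodes σ)
    (hM : M.IsIMAG) {a b : N} (hab : a ≠ b) (ha : a ∈ M.nodes) (hb : b ∈ M.nodes)
    (h : (M.canonicalSADMG σ).graph.InducingPathBtw ∅ (M.canonicalSADMG σ).sel a b) :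
    M.adj a b := by
  have hwf := hM.1.1
  by_contra hnadj
  obtain ⟨w, hp, hwa, hwb, hw⟩ := h
  have hcol : ∀ i, 0 < i → i < w.len → w.ColliderAt i := fun i h0 h1 =>
    (hw.1 i h0 h1).resolve_left (Set.notMem_empty _)
  have hnodes : ∀ i ≤ w.len, w.f i ∈ M.nodes := by
    intro i hi
    by_contra hni
    have h0 : 0 < i := Nat.pos_of_ne_zero fun h0 => hni (by rw [h0, show w.f 0 = a from hwa]; exact ha)
    have h1 : i < w.len := lt_of_le_of_ne hi fun h1 => hni (by rw [h1, show w.f w.len = b from hwb]; exact hb)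
    have hsel : ∀ {x}, (M.canonicalSADMG σ).graph.mark (w.f i) x = some Mark.arrow →
        ∃ c, M.undir x c ∧ w.f i = σ s(x, c) := by
      intro x hx
      rcases (hσ.mark_arrow hwf).1 hx with (h | h) | h
      · exact absurd (hwf.mem_nodes_of_mark h.2).1 hni
      · exact h
      · exact absurd (hwf.mem_nodes_of_mark h.1).1 hni
    have htail : ∀ {x}, (M.canonicalSADMG σ).graph.mark (w.f i) x = some Mark.arrow →
        (M.canonicalSADMG σ).graph.mark x (w.f i) = some Mark.tail := fun hx =>
      canonicalSADMG_mark_tail.2 (.inr (hsel hx))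
    obtain ⟨hprev, hnext⟩ := hcol i h0 h1
    have hi1 : i - 1 = 0 := by
      by_contra hne
      have h2 := (hcol (i - 1) (by omega) (by omega)).2
      rw [show i - 1 + 1 = i by omega, htail hprev] at h2
      simp at h2
    have hi2 : i + 1 = w.len := by
      by_contra hne
      have h2 := (hcol (i + 1) (by omega) (by omega)).1
      rw [show i + 1 - 1 = i by omega, htail hnext] at h2
      simp at h2
    obtain ⟨c, hc, hσc⟩ := hsel hprev
    obtain ⟨d, hd, hσd⟩ := hsel hnext
    rw [hi1, show w.f 0 = a from hwa] at hc hσc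
    rw [hi2, show w.f w.len = b from hwb] at hd hσd
    rcases Sym2.eq_iff.1 (hσ.inj a c b d hc hd (hσc.symm.trans hσd)) with h | h
    · exact hab h.1
    · exact hnadj (adj_of_mark (h.2 ▸ hc).1)
  have hdir : ∀ i ≤ w.len, ∀ j ≤ w.len, M.selDir σ (w.f i) (w.f j) → M.dir (w.f i) (w.f j) :=
    fun i _ j hj h => hσ.dir_of_selDir h (hnodes j hj)
  have harrow : ∀ i ≤ w.len, ∀ j ≤ w.len,
      (M.canonicalSADMG σ).graph.mark (w.f i) (w.f j) = some Mark.arrow →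
      M.mark (w.f i) (w.f j) = some Mark.arrow := by
    intro i hi j hj h
    rcases (hσ.mark_arrow hwf).1 h with h | h
    · exact (hdir j hj i hi h).2
    · exact h.1
  let w' : GWalk M :=
    { len := w.len
      f := w.f
      hadj := by
        intro i hi
        rcases canonicalSADMG_adj.1 (w.hadj i hi) with h | h | h
        · exact adj_of_mark (hdir i (by omega) (i + 1) (by omega) h).1
        · exact adj_of_mark (hdir (i + 1) (by omega) i (by omega) h).2
        · exact adj_of_mark h.1 }
  have hcol' : ∀ i, 0 < i → i < w.len → w'.ColliderAt i := fun i h0 h1 =>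
    ⟨harrow i (by omega) (i - 1) (by omega) (hcol i h0 h1).1,
      harrow i (by omega) (i + 1) (by omega) (hcol i h0 h1).2⟩
  refine hM.1.2.2.2.2.2.2 a b hab ha hb hnadj ⟨w', hp, hwa, hwb,
    fun i h0 h1 => .inr (hcol' i h0 h1), fun i h0 h1 _ => ?_⟩
  have := hw.2 i h0 h1 (hcol i h0 h1)
  rw [hwa, hwb, mem_ancSet_pair_union] at this
  rw [show w'.first = a from hwa, show w'.last = b from hwb, mem_ancSet_pair_union]
  rcases this with h | h | h
  · exact .inl (hσ.anc_of_anc hwf h ha)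
  · exact .inr (.inl (hσ.anc_of_anc hwf h hb))
  · exact absurd h (hσ.notMem_ancSet_sel hM.1 (hcol' i h0 h1).1)

theorem FreshNodes.representsS {σ : Sym2 N → N} (hσ : M.FreshNodes σ) (hM : M.IsIMAG) :
    RepresentsS M (M.canonicalSADMG σ) := by
  have hwf := hM.1.1
  refine ⟨rfl, ?_, ?_, ?_, ?_⟩
  · have hd : Disjoint M.outputs (M.canonicalSADMG σ).sel :=
      Set.disjoint_left.2 fun a ha hs => hσ.sel_notMem hs (.inr ha)
    exact (Set.union_sdiff_cancel_right hd.le_bot).symm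
  · intro a b hab ha hb
    exact ⟨fun h => ⟨fun hI => hM.1.2.2.1 a hI.1 b hI.2 h, hσ.inducingPathBtw_of_adj hM h⟩,
      fun h => hσ.adj_of_inducingPathBtw hM hab ha hb h.2⟩
  · intro a b h hanc
    rcases mem_ancSet_singleton_union.1 hanc with h' | h'
    · have hab := hσ.anc_of_anc hwf h' (hwf.mem_nodes_of_mark h).2
      rcases hM.edge_cases (adj_of_mark h) with h' | h' | h' | h'
      · simpa [h] using h'.1
      · exact hM.1.2.2.2.1 b a h' hab
      · exact hM.1.2.2.2.2.1 a b hab h'.symm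
      · simpa [h] using h'.1
    · exact hσ.notMem_ancSet_sel hM.1 h h'
  · intro a b h
    rw [mem_ancSet_singleton_union]
    have hstep : ∀ {c}, M.selDir σ a c → (M.canonicalSADMG σ).graph.anc a c :=
      fun h => .single ((hσ.dir_iff hwf).2 h)
    rcases hM.edge_cases (adj_of_mark h) with h' | h' | h' | h'
    · exact .inl (hstep (.inl h'))
    · simpa [h] using h'.2
    · simpa [h] using h'.1
    · exact .inr ⟨σ s(a, b), ⟨a, b, h', rfl⟩, hstep (.inr ⟨b, h', rfl⟩)⟩

/-- There is a walk from `a` to `b` with at least one edge, all of whose interior nodes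
satisfy the conditions for being `C`-open, and which ends with mark `m` at `b`. -/
def OpenTo (H : MixedGraph N) (C : Set N) (a b : N) (m : Option Mark) : Prop :=
  ∃ w : GWalk H, w.first = a ∧ w.last = b ∧ 0 < w.len ∧
    H.mark (w.f w.len) (w.f (w.len - 1)) = m ∧
    ∀ i, 0 < i → i < w.len →
      (¬ w.ColliderAt i → w.f i ∉ C) ∧ (w.ColliderAt i → w.f i ∈ H.ancSet C)

theorem OpenTo.of_adj {H : MixedGraph N} {a b : N} (h : H.adj a b) (C : Set N) :
    H.OpenTo C a b (H.mark b a) :=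
  ⟨edgeWalk h, rfl, rfl, Nat.one_pos, rfl, fun i h0 h1 => by
    simp only [edgeWalk] at h1
    omega⟩

theorem OpenTo.snoc {H : MixedGraph N} {C : Set N} {a b c : N} {m : Option Mark}
    (h : H.OpenTo C a b m) (hbc : H.adj b c)
    (hn : ¬ (m = some Mark.arrow ∧ H.mark b c = some Mark.arrow) → b ∉ C)
    (hc : m = some Mark.arrow ∧ H.mark b c = some Mark.arrow → b ∈ H.ancSet C) :
    H.OpenTo C a c (H.mark c b) := by
  obtain ⟨w, ha, hb, hpos, hm, hw⟩ := h
  set f : ℕ → N := fun i => if i ≤ w.len then w.f i else c with hf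
  have hlo : ∀ i, i ≤ w.len → f i = w.f i := fun i h => if_pos h
  have hend : f (w.len + 1) = c := if_neg (by omega)
  have hlen : w.f w.len = b := hb
  let w' : GWalk H :=
    { len := w.len + 1
      f := f
      hadj := by
        intro i hi
        rcases (Nat.lt_succ_iff.1 hi).eq_or_lt with rfl | h
        · rw [hend, hlo _ le_rfl, hlen]
          exact hbc
        · rw [hlo i (by omega), hlo (i + 1) (by omega)]
          exact w.hadj i h }
  refine ⟨w', (hlo 0 (by omega)).trans ha, hend, Nat.succ_pos _, ?_, ?_⟩
  · change H.mark (f (w.len + 1)) (f (w.len + 1 - 1)) = _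
    rw [hend, Nat.add_sub_cancel, hlo _ le_rfl, hlen]
  · intro i h0 (h1 : i < w.len + 1)
    change (¬ (H.mark (f i) (f (i - 1)) = _ ∧ H.mark (f i) (f (i + 1)) = _) → f i ∉ C) ∧
      (H.mark (f i) (f (i - 1)) = _ ∧ H.mark (f i) (f (i + 1)) = _ → f i ∈ H.ancSet C)
    rcases (Nat.lt_succ_iff.1 h1).eq_or_lt with rfl | h
    · rw [hend, hlo _ le_rfl, hlo _ (by omega), hm, hlen]
      exact ⟨hn, hc⟩
    · rw [hlo i (by omega), hlo (i - 1) (by omega), hlo (i + 1) (by omega)]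
      exact hw i h0 h

theorem magHardManip_notMem_of_arrow
    (harr : ∀ a ∈ M.inputs, ∀ b, M.mark a b ≠ some Mark.arrow) {T : Set N} {a b : N}
    (hadj : (magHardManip M T).adj a b) : ¬ (a ∈ T ∧ M.mark a b = some Mark.arrow) ∧
      ¬ (b ∈ T ∧ M.mark b a = some Mark.arrow) := by
  simp only [adj, magHardManip] at hadj
  split_ifs at hadj with h
  · simp at hadj
  · have h1 := fun ha => harr a ha b
    have h2 := fun hb => harr b hb a
    tauto

/-- Every edge of the manipulated iMAG is an edge of the manipulated canonical isADMG or
an undirected edge that was replaced by `u → s ← v`. -/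
theorem FreshNodes.hardManip_edge {σ : Sym2 N → N} (hσ : M.FreshNodes σ) (hM : M.IsIMAG)
    {T : Set N} (hT : T ⊆ M.nodes) {u v : N} (h : (magHardManip M T).adj u v) :
    ((admgHardManip (M.canonicalSADMG σ).graph T).mark u v = (magHardManip M T).mark u v ∧
      (admgHardManip (M.canonicalSADMG σ).graph T).mark v u = (magHardManip M T).mark v u) ∨
    ((magHardManip M T).mark u v = some Mark.tail ∧
      (magHardManip M T).mark v u = some Mark.tail ∧
      ∃ s ∈ (M.canonicalSADMG σ).sel,
        (admgHardManip (M.canonicalSADMG σ).graph T).dir u s ∧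
        (admgHardManip (M.canonicalSADMG σ).graph T).dir v s) := by
  have hwf := hM.1.1
  have hmag : (magHardManip M T).mark u v = M.mark u v ∧
      (magHardManip M T).mark v u = M.mark v u := by
    simp only [adj, magHardManip] at h ⊢
    split_ifs at h with h'
    · simp at h
    · rw [if_neg h', if_neg (by tauto)]
      exact ⟨rfl, rfl⟩
  have hMadj : M.adj u v := by
    rw [adj, ← hmag.1]
    exact h
  have harr := magHardManip_notMem_of_arrow hM.1.2.1 h
  rw [hmag.1, hmag.2]
  have hkeep : (M.canonicalSADMG σ).graph.mark u v = M.mark u v →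
      (M.canonicalSADMG σ).graph.mark v u = M.mark v u →
      (admgHardManip (M.canonicalSADMG σ).graph T).mark u v = M.mark u v ∧
      (admgHardManip (M.canonicalSADMG σ).graph T).mark v u = M.mark v u := by
    intro h1 h2
    simp only [admgHardManip, h1, h2]
    rw [if_neg (by tauto), if_neg (by tauto)]
    exact ⟨rfl, rfl⟩
  rcases hM.edge_cases hMadj with h | h | h | h
  · refine .inl (hkeep ?_ ?_)
    · rw [h.1, canonicalSADMG_mark_tail]
      exact .inl h
    · rw [h.2, hσ.mark_arrow hwf]
      exact .inl (.inl h)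
  · refine .inl (hkeep ?_ ?_)
    · rw [h.2, hσ.mark_arrow hwf]
      exact .inl (.inl h)
    · rw [h.1, canonicalSADMG_mark_tail]
      exact .inl h
  · refine .inl (hkeep ?_ ?_)
    · rw [h.1, hσ.mark_arrow hwf]
      exact .inr h
    · rw [h.2, hσ.mark_arrow hwf]
      exact .inr h.symm
  · have hs : σ s(u, v) ∈ (M.canonicalSADMG σ).sel := ⟨u, v, h, rfl⟩
    have hsT : σ s(u, v) ∉ T := fun h => hσ.sel_notMem hs (hT h)
    have hdir : ∀ {x}, M.selDir σ x (σ s(u, v)) →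
        (admgHardManip (M.canonicalSADMG σ).graph T).dir x (σ s(u, v)) := by
      intro x hx
      obtain ⟨h1, h2⟩ := (hσ.dir_iff hwf).2 hx
      simp [dir, admgHardManip, h1, h2, hsT]
    exact .inr ⟨h.1, h.2, _, hs, hdir (.inr ⟨v, h, rfl⟩),
      hdir (.inr ⟨u, h.symm, by rw [Sym2.eq_swap]⟩)⟩

theorem FreshNodes.hardManip_ancSet {σ : Sym2 N → N} (hσ : M.FreshNodes σ) (hM : M.IsIMAG)
    {T : Set N} (hT : T ⊆ M.nodes) (C : Set N) :
    (magHardManip M T).ancSet C ⊆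
      (admgHardManip (M.canonicalSADMG σ).graph T).ancSet C := by
  rintro a ⟨c, hc, h⟩
  refine ⟨c, hc, Relation.ReflTransGen.mono (fun x y hxy => ?_) _ _ h⟩
  rcases hσ.hardManip_edge hM hT (adj_of_mark hxy.1) with h | h
  · exact ⟨h.1.trans hxy.1, h.2.trans hxy.2⟩
  · simpa [hxy.2] using h.2.1

/-- Open walks in the manipulated iMAG give open walks in its manipulated canonical
isADMG. -/
theorem FreshNodes.idSepSimple_magHardManip {σ : Sym2 N → N} (hσ : M.FreshNodes σ)
    (hM : M.IsIMAG) {X B C T : Set N} (hT : T ⊆ M.nodes) (hX : X ⊆ M.outputs \ T)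
    (hB : B ⊆ M.nodes) (hXB : Disjoint X B)
    (hsep : IdSepSimple (admgHardManip (M.canonicalSADMG σ).graph T) X B
      (C ∪ T ∪ (M.canonicalSADMG σ).sel)) :
    IdSepSimple (magHardManip M T) X B (C ∪ T) := by
  intro w hfirst hlast ⟨ho₁, ho₂, ho⟩
  have hwf := hM.1.1
  set A := M.canonicalSADMG σ with hA
  set H := admgHardManip A.graph T with hH
  set Z := C ∪ T ∪ A.sel with hZ
  have hZmem : ∀ {x}, x ∈ M.nodes → x ∉ C ∪ T → x ∉ Z := fun hx h =>
    fun h' => h'.elim h fun hs => hσ.sel_notMem hs hx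
  have hKadj : ∀ {x y}, (magHardManip M T).adj x y → M.adj x y := by
    intro x y h
    obtain ⟨m, hm⟩ := Option.isSome_iff_exists.1 h
    exact adj_of_mark (magHardManip_mark hm)
  have hfirstn : w.first ∈ M.nodes := .inr (hX hfirst).1
  have hlastn : w.last ∈ M.nodes := by
    rcases hlast with h | h | h
    · exact hB h
    · exact .inl h
    · exact hT h.1
  have hpos : 0 < w.len := by
    refine Link.len_pos w (fun h => ?_) rfl rfl
    rw [← h] at hlast
    rcases hlast with h | h | h
    · exact Set.disjoint_left.1 hXB hfirst h
    · exact hwf.1.le_bot ⟨h, (hX hfirst).1⟩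
    · exact (hX hfirst).2 h.1
  have hadj_of : ∀ {x y : N}, (magHardManip M T).adj x y → H.mark x y = (magHardManip M T).mark x y → H.adj x y :=
    fun h h' => by rw [adj, h']; exact h
  have hsel : ∀ {x s v : N} {m}, H.OpenTo Z x s m → s ∈ A.sel → m = some Mark.arrow →
      H.dir v s → H.OpenTo Z x v (some Mark.tail) := by
    intro x s v m h hs hm hvs
    rw [← hvs.1]
    exact h.snoc (adj_of_mark hvs.2) (fun hn => absurd ⟨hm, hvs.2⟩ hn)
      fun _ => subset_ancSet _ (.inr hs)
  have hopen : ∀ k, k < w.len →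
      H.OpenTo Z w.first (w.f (k + 1)) ((magHardManip M T).mark (w.f (k + 1)) (w.f k)) := by
    intro k hk
    induction k with
    | zero =>
      have hadj := w.hadj 0 hk
      rcases hσ.hardManip_edge hM hT hadj with h | ⟨_, h2, s, hs, hus, hvs⟩
      · rw [← h.2]
        exact OpenTo.of_adj (hadj_of hadj h.1) _
      · rw [h2]
        exact hsel (OpenTo.of_adj (adj_of_mark hus.1) _) hs hus.2 hvs
    | succ k ih =>
      have ih := ih (by omega)
      have hadj := w.hadj (k + 1) hk
      have hk' := ho (k + 1) (by omega) hk
      have hn := (hwf.2.2.2.2.2 _ _ (hKadj hadj)).1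
      simp only [GWalk.ColliderAt, Nat.add_sub_cancel] at hk'
      have hanc := ancSet_mono (G := H) (Set.subset_union_left : C ∪ T ⊆ Z)
      rcases hσ.hardManip_edge hM hT hadj with h | ⟨h1, h2, s, hs, hus, hvs⟩
      · rw [← h.2]
        refine ih.snoc (hadj_of hadj h.1) (fun hnc => ?_) (fun hc => ?_)
        · rw [hH, h.1] at hnc
          exact hZmem hn (hk'.1 hnc)
        · rw [hH, h.1] at hc
          exact hanc (hσ.hardManip_ancSet hM hT _ (hk'.2 hc))
      · rw [h2]
        refine hsel (ih.snoc (adj_of_mark hus.1) (fun _ => ?_) (fun hc => ?_)) hs hus.2 hvs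
        · exact hZmem hn (hk'.1 fun hc => by simp [h1] at hc)
        · exact absurd (hus.1.symm.trans hc.2) (by simp)
  obtain ⟨v, hv1, hv2, -, -, hv⟩ := hopen (w.len - 1) (by omega)
  rw [show w.len - 1 + 1 = w.len by omega] at hv2
  refine hsep v (hv1 ▸ hfirst) ?_ ⟨?_, ?_, hv⟩
  · rw [hv2]
    exact hlast.imp id (Or.imp id fun h => ⟨h.1, .inl h.2⟩)
  · rw [hv1]
    exact hZmem hfirstn ho₁
  · rw [hv2]
    exact hZmem hlastn ho₂

end MixedGraph

/-- Let `M` be an iMAG, `T ⊆ I ∪ V`, `A ⊆ V \ T`, and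
`B, C ⊆ (I ∪ V) \ T` pairwise disjoint.  Then `A` is id-separated from `B` given
`C ∪ T` in the hard-manipulated graph `M_{do(T)}` if and only if, for every isADMG
`A' ∈ [M]_G`, `A` is id-separated from `B` given `C ∪ T ∪ S_{A'}` in `A'_{do(T)}`. -/
theorem statement12 {N : Type} [Infinite N] (M : MixedGraph N) (hM : M.IsIMAG)
    (T : Set N) (hT : T ⊆ M.nodes)
    (A B C : Set N) (hA : A ⊆ M.outputs \ T)
    (hB : B ⊆ M.nodes \ T) (hC : C ⊆ M.nodes \ T)
    (hAB : Disjoint A B) (hAC : Disjoint A C) (hBC : Disjoint B C) :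
    IdSepSimple (magHardManip M T) A B (C ∪ T) ↔
      ∀ A' : SADMG N, A'.WF → RepresentsS M A' →
        IdSepSimple (admgHardManip A'.graph T) A B (C ∪ T ∪ A'.sel) := by
  constructor
  · intro h A' hA' hR
    exact hR.idSepSimple_admgHardManip hM hA' hA hAB h
  · intro h
    obtain ⟨σ, hσ⟩ := MixedGraph.exists_freshNodes hM.1.1
    exact hσ.idSepSimple_magHardManip hM hT hA (fun b hb => (hB hb).1) hAB
      (h _ (hσ.canonicalSADMG_wf hM.1) (hσ.representsS hM))

end
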